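/- arXiv:2507.08433 — 9 statements merged into one kernel-verified Lean document; each statement's English description precedes it below -/
import Mathlib

section
/- Let G be a finite connected simple graph of order n ≥ 2. Then (a) every k-multiset antiresolving set of G satisfies 1 ≤ k ≤ n−1, and (b) G contains an (n−1)-multiset antiresolving set if and only if G has a vertex of degree n−1. -/
open Finset

/-- The multiset representation of `v` with respect to `S`:
the multiset of distances from `v` to the vertices of `S`, counted with multiplicity. -/
noncomputable def mrep {V : Type*} (G : SimpleGraph V) (S : Finset V) (v : V) : Multiset ℕ :=
  S.val.map (fun s => G.dist v s)

open scoped Classical in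
/-- The set of vertices outside `S` having the same multiset representation as `u`. -/
noncomputable def mclass {V : Type*} [Fintype V] (G : SimpleGraph V) (S : Finset V)
    (u : V) : Finset V :=
  Finset.univ.filter (fun v => v ∉ S ∧ mrep G S v = mrep G S u)

open scoped Classical in
/-- `S` is a `k`-multiset antiresolving set (`k`-MARS) of `G`: `S` is nonempty, its complement
is nonempty, and `k` is the largest integer such that every vertex `u ∉ S` has at least `k`
vertices outside `S` (including itself) with its same multiset representation. -/
def IsMARS {V : Type*} [Fintype V] (G : SimpleGraph V) (S : Finset V) (k : ℕ) : Prop :=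
  S.Nonempty ∧ Sᶜ.Nonempty ∧
    (∀ u ∉ S, k ≤ (mclass G S u).card) ∧ (∃ u ∉ S, (mclass G S u).card = k)

theorem mem_mclass {V : Type*} [Fintype V] (G : SimpleGraph V) {S : Finset V} {u v : V} :
    v ∈ mclass G S u ↔ v ∉ S ∧ mrep G S v = mrep G S u := by
  simp [mclass]

theorem self_mem_mclass {V : Type*} [Fintype V] (G : SimpleGraph V) {S : Finset V} {u : V}
    (hu : u ∉ S) : u ∈ mclass G S u := by
  simp [mem_mclass, hu]

theorem card_mclass_add_card_le {V : Type*} [Fintype V] (G : SimpleGraph V) (S : Finset V)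
    (u : V) : (mclass G S u).card + S.card ≤ Fintype.card V := by
  classical
  have hdisj : Disjoint (mclass G S u) S :=
    Finset.disjoint_left.2 fun v hv => ((mem_mclass G).1 hv).1
  rw [← Finset.card_union_of_disjoint hdisj]
  exact Finset.card_le_univ _

theorem mem_mclass_singleton {V : Type*} [Fintype V] (G : SimpleGraph V) (s u v : V) :
    v ∈ mclass G {s} u ↔ v ≠ s ∧ G.dist v s = G.dist u s := by
  simp [mem_mclass, mrep]

/-- for a finite connected graph `G` of order `n ≥ 2`:
(a) every `k`-multiset antiresolving set satisfies `1 ≤ k ≤ n - 1`, and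
(b) `G` contains an `(n-1)`-multiset antiresolving set iff it has a vertex of degree `n-1`. -/
theorem stmt1 {V : Type*} [Fintype V] (G : SimpleGraph V) [DecidableRel G.Adj]
    (hG : G.Connected) (n : ℕ) (hn : n = Fintype.card V) (h2 : 2 ≤ n) :
    (∀ (S : Finset V) (k : ℕ), IsMARS G S k → 1 ≤ k ∧ k ≤ n - 1) ∧
    ((∃ S : Finset V, IsMARS G S (n - 1)) ↔ ∃ v : V, G.degree v = n - 1) := by
  classical
  subst hn
  refine ⟨?_, ?_, ?_⟩
  · rintro S k ⟨hS, -, -, u, hu, rfl⟩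
    have hle := card_mclass_add_card_le G S u
    have hpos : 0 < (mclass G S u).card := Finset.card_pos.2 ⟨u, self_mem_mclass G hu⟩
    have hSpos := hS.card_pos
    omega
  · rintro ⟨S, hS, -, -, u, hu, hk⟩
    have hle := card_mclass_add_card_le G S u
    have hSpos := hS.card_pos
    obtain ⟨s, rfl⟩ := Finset.card_eq_one.1 (show S.card = 1 by omega)
    have hsub : mclass G {s} u ⊆ Finset.univ.erase s := fun v hv => by
      simpa using ((mem_mclass_singleton G s u v).1 hv).1
    have heq : mclass G {s} u = Finset.univ.erase s := Finset.eq_of_subset_of_card_le hsub <| by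
      rw [hk, Finset.card_erase_of_mem (Finset.mem_univ s), Finset.card_univ]
    have hdist : ∀ v, v ≠ s → G.dist v s = G.dist u s := fun v hv =>
      ((mem_mclass_singleton G s u v).1 (by simpa [heq] using hv)).2
    have : Nontrivial V := Fintype.one_lt_card_iff_nontrivial.1 h2
    obtain ⟨w, hw⟩ := hG.preconnected.exists_adj_of_nontrivial s
    have hu1 : G.dist u s = 1 := by
      rw [← hdist w hw.ne', SimpleGraph.dist_eq_one_iff_adj]
      exact hw.symm
    refine ⟨s, (G.degree_eq_card_sub_one s).2 fun v hv => ?_⟩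
    exact (SimpleGraph.dist_eq_one_iff_adj.1 ((hdist v hv.symm).trans hu1)).symm
  · rintro ⟨s, hs⟩
    have hadj := (G.degree_eq_card_sub_one s).1 hs
    have hdist : ∀ v, v ≠ s → G.dist v s = 1 := fun v hv =>
      SimpleGraph.dist_eq_one_iff_adj.2 (hadj hv.symm).symm
    have hcard : ∀ u ∉ ({s} : Finset V), (mclass G {s} u).card = Fintype.card V - 1 := by
      intro u hu
      have heq : mclass G {s} u = Finset.univ.erase s := by
        ext v
        rw [mem_mclass_singleton, hdist u (by simpa using hu)]
        simpa using hdist v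
      rw [heq, Finset.card_erase_of_mem (Finset.mem_univ s), Finset.card_univ]
    obtain ⟨u, hu⟩ := Fintype.exists_ne_of_one_lt_card h2 s
    have hu' : u ∉ ({s} : Finset V) := by simpa using hu
    exact ⟨{s}, Finset.singleton_nonempty s, ⟨u, by simpa using hu⟩,
      fun v hv => (hcard v hv).ge, u, hu', hcard u hu'⟩
end

section
/- Every tree T with at least three vertices contains a k-multiset antiresolving set for some integer k ≥ 2; that is, there exists a nonempty proper subset S of V(T) such that every vertex u ∈ V(T)∖S satisfies |{v ∈ V(T)∖S : m(v|S) = m(u|S)}| ≥ 2. -/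
open Finset

namespace SimpleGraph

variable {V : Type*} {G : SimpleGraph V}

/-- On a geodesic there is a vertex at every intermediate distance. -/
lemma Connected.exists_dist_eq_add (hG : G.Connected) {u v : V} {i j : ℕ}
    (h : G.dist u v = i + j) : ∃ w, G.dist u w = i ∧ G.dist w v = j := by
  obtain ⟨p, hp⟩ := hG.exists_walk_length_eq_dist u v
  have h₁ := dist_le (p.take i)
  have h₂ := dist_le (p.drop i)
  have h₃ := hG.dist_triangle (u := u) (v := p.getVert i) (w := v)
  rw [Walk.take_length] at h₁
  rw [Walk.drop_length] at h₂
  exact ⟨p.getVert i, by omega, by omega⟩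

lemma IsTree.length_eq_dist (hG : G.IsTree) {u v : V} {p : G.Walk u v} (hp : p.IsPath) :
    p.length = G.dist u v := by
  obtain ⟨q, hq, hl⟩ := hG.connected.exists_path_of_dist u v
  rw [(hG.existsUnique_path u v).unique hp hq, hl]

lemma Walk.dist_add_dist_of_mem_support (hG : G.Connected) {u v w : V} {p : G.Walk u v}
    (hp : p.length = G.dist u v) (hw : w ∈ p.support) :
    G.dist u w + G.dist w v = G.dist u v := by
  classical
  have h₁ := dist_le (p.takeUntil w hw)
  have h₂ := dist_le (p.dropUntil w hw)
  have h₃ := hG.dist_triangle (u := u) (v := w) (w := v)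
  have h₄ := congrArg Walk.length (p.take_spec hw)
  rw [Walk.length_append] at h₄
  omega

/-- In a tree, if `x` is on the `a` side and `v` on the `b` side of an edge `ab`, then the path
from `x` to `v` runs through that edge. -/
lemma IsTree.dist_eq_of_adj (hG : G.IsTree) {a b x v : V} (hab : G.Adj a b)
    (hx : G.dist x b = G.dist x a + 1) (hv : G.dist a v = G.dist b v + 1) :
    G.dist x v = G.dist x a + 1 + G.dist b v := by
  obtain ⟨p, hp, hpl⟩ := hG.connected.exists_path_of_dist x a
  obtain ⟨q, hq, hql⟩ := hG.connected.exists_path_of_dist b v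
  have hpath : (p.append (Walk.cons hab q)).IsPath := by
    rw [Walk.isPath_def, Walk.support_append, Walk.support_cons, List.tail_cons,
      List.nodup_append]
    refine ⟨hp.support_nodup, hq.support_nodup, ?_⟩
    rintro w hw _ hw' rfl
    have h₁ := Walk.dist_add_dist_of_mem_support hG.connected hpl hw
    have h₂ := Walk.dist_add_dist_of_mem_support hG.connected hql hw'
    have h₃ := hG.connected.dist_triangle (u := x) (v := w) (w := b)
    have h₄ := hG.connected.dist_triangle (u := a) (v := w) (w := v)
    rw [dist_comm (u := w) (v := b)] at h₃
    rw [dist_comm (u := a) (v := w)] at h₄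
    omega
  rw [← hG.length_eq_dist hpath, Walk.length_append, Walk.length_cons, hpl, hql]
  omega

/-- In a tree of diameter `2 * r`, every vertex other than the center has a distinct vertex at the
same distance from the center. -/
lemma IsTree.exists_ne_dist_eq_of_center (hG : G.IsTree) {u v c : V} {r : ℕ}
    (huc : G.dist u c = r) (hcv : G.dist c v = r) (huv : G.dist u v = 2 * r)
    (hmax : ∀ x y, G.dist x y ≤ 2 * r) {x : V} (hx : x ≠ c) :
    ∃ y, y ≠ x ∧ y ≠ c ∧ G.dist y c = G.dist x c := by
  have hpos : 0 < G.dist x c := hG.connected.pos_dist_of_ne hx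
  have hle : G.dist x c ≤ r := by
    rcases Nat.eq_zero_or_pos r with rfl | hr
    · have := hmax x c
      omega
    obtain ⟨b, hub, hbc⟩ := hG.connected.exists_dist_eq_add (u := u) (v := c) (i := r - 1) (j := 1)
      (by omega)
    have hadj : G.Adj b c := dist_eq_one_iff_adj.mp hbc
    rcases hG.dist_eq_dist_add_one_of_adj x hadj with h | h
    · have := hG.dist_eq_of_adj (a := c) (b := b) (x := x) (v := u) hadj.symm h
        (by rw [dist_comm, dist_comm (u := b)]; omega)
      have := hmax x u
      rw [dist_comm (u := b)] at *
      omega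
    · have h₁ := hG.connected.dist_triangle (u := u) (v := b) (w := v)
      have h₂ := hG.connected.dist_triangle (u := b) (v := c) (w := v)
      have := hG.dist_eq_of_adj (a := b) (b := c) (x := x) (v := v) hadj h (by omega)
      have := hmax x v
      omega
  obtain ⟨w₁, h₁, hw₁⟩ := hG.connected.exists_dist_eq_add (u := u) (v := c)
    (i := r - G.dist x c) (j := G.dist x c) (by omega)
  obtain ⟨w₂, h₂, hw₂⟩ := hG.connected.exists_dist_eq_add (u := c) (v := v)
    (i := G.dist x c) (j := r - G.dist x c) (by omega)
  have hne : w₁ ≠ w₂ := by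
    rintro rfl
    have := hG.connected.dist_triangle (u := u) (v := w₁) (w := v)
    omega
  rw [dist_comm] at h₂
  have hc : ∀ w, G.dist w c = G.dist x c → w ≠ c := by
    rintro w hw rfl
    rw [dist_self] at hw
    omega
  by_cases hxw : w₁ = x
  · exact ⟨w₂, hxw ▸ hne.symm, hc _ h₂, h₂⟩
  · exact ⟨w₁, hxw, hc _ hw₁, hw₁⟩

/-- In a tree of diameter `2 * r + 1` with central edge `ab`, every vertex on the `a` side has a
mirror vertex on the `b` side. -/
lemma IsTree.exists_dist_eq_of_center_edge (hG : G.IsTree) {a b v : V} {r : ℕ} (hab : G.Adj a b)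
    (hav : G.dist a v = r + 1) (hbv : G.dist b v = r) (hmax : ∀ x y, G.dist x y ≤ 2 * r + 1)
    {x : V} (hx : G.dist x b = G.dist x a + 1) :
    ∃ y, G.dist y b = G.dist x a ∧ G.dist y a = G.dist x b := by
  have h := hG.dist_eq_of_adj (v := v) hab hx (by omega)
  have := hmax x v
  obtain ⟨w, hw, hw'⟩ := hG.connected.exists_dist_eq_add (u := b) (v := v)
    (i := G.dist x a) (j := r - G.dist x a) (by omega)
  have h₁ := hG.connected.dist_triangle (u := a) (v := b) (w := w)
  have h₂ := hG.connected.dist_triangle (u := a) (v := w) (w := v)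
  rw [dist_eq_one_iff_adj.mpr hab] at h₁
  exact ⟨w, by rw [dist_comm, hw], by rw [dist_comm]; omega⟩

/-- A set outside of which every vertex has a twin is a multiset antiresolving set for some
`k ≥ 2`. -/
lemma exists_isMARS_of_twins [Fintype V] {S : Finset V} (hS : S.Nonempty) (hS' : ∃ u, u ∉ S)
    (h : ∀ u ∉ S, ∃ v, v ≠ u ∧ v ∉ S ∧ mrep G S v = mrep G S u) :
    ∃ k, 2 ≤ k ∧ IsMARS G S k := by
  classical
  have hne : (univ.filter (· ∉ S)).Nonempty := by simpa [Finset.Nonempty] using hS'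
  obtain ⟨u, hu, hmin⟩ := exists_min_image _ (fun u => (mclass G S u).card) hne
  rw [mem_filter_univ] at hu
  refine ⟨(mclass G S u).card, ?_, hS, ?_, fun w hw => hmin w (by simpa using hw), u, hu, rfl⟩
  · obtain ⟨v, hvu, hvS, hv⟩ := h u hu
    exact one_lt_card.mpr ⟨v, by simp [mclass, hvS, hv], u, by simp [mclass, hu], hvu⟩
  · obtain ⟨u, hu⟩ := hS'
    exact ⟨u, by simpa using hu⟩

end SimpleGraph

open SimpleGraph in
/-- every tree with at least three vertices contains a `k`-multiset
antiresolving set for some `k ≥ 2`. -/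
theorem stmt2 {V : Type*} [Fintype V] (T : SimpleGraph V) (hT : T.IsTree)
    (h3 : 3 ≤ Fintype.card V) :
    ∃ (k : ℕ) (S : Finset V), 2 ≤ k ∧ IsMARS T S k := by
  classical
  have hconn := hT.connected
  have := hconn.nonempty
  suffices H : ∃ S : Finset V, S.Nonempty ∧ S.card ≤ 2 ∧
      ∀ u ∉ S, ∃ v, v ≠ u ∧ v ∉ S ∧ mrep T S v = mrep T S u by
    obtain ⟨S, hS, hcard, h⟩ := H
    have hS' : ∃ u, u ∉ S := by
      by_contra! hall
      rw [eq_univ_of_forall hall, card_univ] at hcard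
      omega
    obtain ⟨k, hk⟩ := exists_isMARS_of_twins hS hS' h
    exact ⟨k, S, hk⟩
  obtain ⟨⟨u, v⟩, hmax⟩ := Finite.exists_max (fun p : V × V => T.dist p.1 p.2)
  replace hmax : ∀ x y, T.dist x y ≤ T.dist u v := fun x y => hmax (x, y)
  rcases Nat.even_or_odd' (T.dist u v) with ⟨r, hr | hr⟩
  · obtain ⟨c, huc, hcv⟩ := hconn.exists_dist_eq_add (u := u) (v := v) (i := r) (j := r) (by omega)
    refine ⟨{c}, singleton_nonempty c, by simp, fun x hx => ?_⟩
    obtain ⟨y, hyx, hyc, hy⟩ := hT.exists_ne_dist_eq_of_center huc hcv hr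
      (fun x y => hr ▸ hmax x y) (by simpa using hx)
    exact ⟨y, hyx, by simpa using hyc, by simp [mrep, hy]⟩
  · rw [hr] at hmax
    obtain ⟨a, hua, hav⟩ := hconn.exists_dist_eq_add (u := u) (v := v) (i := r) (j := r + 1) (by omega)
    obtain ⟨b, hab, hbv⟩ := hconn.exists_dist_eq_add (u := a) (v := v) (i := 1) (j := r) (by omega)
    have hub : T.dist u b = r + 1 := by
      have h₁ := hconn.dist_triangle (u := u) (v := a) (w := b)
      have h₂ := hconn.dist_triangle (u := u) (v := b) (w := v)
      omega
    rw [dist_eq_one_iff_adj] at hab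
    have hrep : ∀ x, mrep T {a, b} x = {T.dist x a, T.dist x b} := fun x => by
      simp [mrep, hab.ne]
    refine ⟨{a, b}, insert_nonempty _ _, card_le_two, fun x hx => ?_⟩
    obtain ⟨y, hya, hyb⟩ : ∃ y, T.dist y b = T.dist x a ∧ T.dist y a = T.dist x b := by
      rcases hT.dist_eq_dist_add_one_of_adj x hab with h | h
      · rw [dist_comm] at hua hub
        obtain ⟨y, hy⟩ := hT.exists_dist_eq_of_center_edge hab.symm hub hua hmax h
        exact ⟨y, hy.symm⟩
      · exact hT.exists_dist_eq_of_center_edge hab hav hbv hmax h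
    simp only [mem_insert, mem_singleton, not_or] at hx
    refine ⟨y, ?_, ?_, ?_⟩
    · rintro rfl
      exact hT.dist_ne_of_adj y hab hyb
    · simp only [mem_insert, mem_singleton, not_or]
      rw [← hconn.dist_eq_zero_iff.not, ← hconn.dist_eq_zero_iff.not, hya, hyb,
        hconn.dist_eq_zero_iff, hconn.dist_eq_zero_iff]
      exact hx.symm
    · rw [hrep, hrep, hya, hyb, Multiset.pair_comm]
end

section
/- Let r ≥ t ≥ 1 be integers with r + t ≥ 2, and let K_{r,t} be the complete bipartite graph with parts of sizes r and t. If t = 1 and r ≥ 2, then κ(K_{r,t}) = r + t − 1; if t ≥ 2, then κ(K_{r,t}) = r + t − 2. Here κ(K_{r,t}) = k means: K_{r,t} contains a k-multiset antiresolving set, and contains no k'-multiset antiresolving set for any k' > k. -/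
open Finset

/-- `κ(G) = k`: `G` contains a `k`-multiset antiresolving set, and contains no
`k'`-multiset antiresolving set for any `k' > k`. -/
def KappaEq {V : Type*} [Fintype V] (G : SimpleGraph V) (k : ℕ) : Prop :=
  (∃ S : Finset V, IsMARS G S k) ∧ ∀ k' > k, ¬ ∃ S : Finset V, IsMARS G S k'

/-- Two distinct nonadjacent vertices with a common neighbour are at distance two. -/
theorem dist_eq_two_of_common_adj {V : Type*} {G : SimpleGraph V} {u v w : V} (huv : u ≠ v)
    (hnadj : ¬ G.Adj u v) (huw : G.Adj u w) (hwv : G.Adj w v) : G.dist u v = 2 := by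
  have hreach : G.Reachable u v := huw.reachable.trans hwv.reachable
  have hpos : 0 < G.dist u v := hreach.pos_dist_of_ne huv
  have hne : G.dist u v ≠ 1 := fun h => hnadj (SimpleGraph.dist_eq_one_iff_adj.mp h)
  have hle : G.dist u v ≤ 2 :=
    SimpleGraph.dist_le (SimpleGraph.Walk.cons huw (SimpleGraph.Walk.cons hwv .nil))
  omega

section

variable {V : Type*} [Fintype V] {G : SimpleGraph V} {S : Finset V}

open scoped Classical in
theorem mclass_subset_compl (u : V) : mclass G S u ⊆ Sᶜ := by
  intro v hv
  simp only [mclass, mem_filter] at hv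
  simpa using hv.2.1

theorem IsMARS.add_card_le {k : ℕ} (h : IsMARS G S k) : k + S.card ≤ Fintype.card V := by
  classical
  obtain ⟨-, -, -, u, -, rfl⟩ := h
  have hle := card_le_card (mclass_subset_compl (G := G) (S := S) u)
  have hS := card_le_univ S
  rw [card_compl] at hle
  omega

/-- If a MARS attains the largest possible value, all vertices outside it share their
multiset representation. -/
theorem IsMARS.mrep_eq {k : ℕ} (h : IsMARS G S k) (hk : Fintype.card V ≤ k + S.card)
    {v w : V} (hv : v ∉ S) (hw : w ∉ S) : mrep G S v = mrep G S w := by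
  classical
  obtain ⟨-, -, -, u, -, rfl⟩ := h
  have heq : mclass G S u = Sᶜ := by
    refine eq_of_subset_of_card_le (mclass_subset_compl u) ?_
    rw [card_compl]
    omega
  have key : ∀ x ∉ S, mrep G S x = mrep G S u := by
    intro x hx
    have hmem : x ∈ mclass G S u := by rw [heq]; simpa using hx
    simp only [mclass, mem_filter] at hmem
    exact hmem.2.2
  rw [key v hv, key w hw]

theorem isMARS_of_mrep_eq {k : ℕ} {m : Multiset ℕ} (hS : S.Nonempty) (hk : 0 < k)
    (hcard : k + S.card = Fintype.card V) (h : ∀ v ∉ S, mrep G S v = m) : IsMARS G S k := by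
  classical
  have hclass : ∀ u ∉ S, (mclass G S u).card = k := by
    intro u hu
    have heq : mclass G S u = Sᶜ := by
      ext v
      simp only [mclass, mem_filter, mem_univ, true_and, mem_compl]
      exact ⟨fun hv => hv.1, fun hv => ⟨hv, by rw [h v hv, h u hu]⟩⟩
    rw [heq, card_compl]
    omega
  have hne : ∃ u, u ∉ S := by
    by_contra! hall
    have := (eq_univ_iff_forall.mpr hall) ▸ hcard
    rw [card_univ] at this
    omega
  obtain ⟨u, hu⟩ := hne
  exact ⟨hS, ⟨u, by simpa using hu⟩, fun v hv => (hclass v hv).ge, u, hu, hclass u hu⟩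

end

section

variable {α β : Type*}

theorem completeBipartiteGraph_dist_inl_inr (a : α) (b : β) :
    (completeBipartiteGraph α β).dist (Sum.inl a) (Sum.inr b) = 1 :=
  SimpleGraph.dist_eq_one_iff_adj.mpr (by simp)

theorem completeBipartiteGraph_dist_inr_inl (a : α) (b : β) :
    (completeBipartiteGraph α β).dist (Sum.inr b) (Sum.inl a) = 1 :=
  SimpleGraph.dist_eq_one_iff_adj.mpr (by simp)

theorem completeBipartiteGraph_dist_inl_inl [Nonempty β] {a b : α} (h : a ≠ b) :
    (completeBipartiteGraph α β).dist (Sum.inl a) (Sum.inl b) = 2 := by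
  obtain ⟨c⟩ := ‹Nonempty β›
  exact dist_eq_two_of_common_adj (w := Sum.inr c) (by simpa using h) (by simp) (by simp)
    (by simp)

theorem completeBipartiteGraph_dist_inr_inr [Nonempty α] {a b : β} (h : a ≠ b) :
    (completeBipartiteGraph α β).dist (Sum.inr a) (Sum.inr b) = 2 := by
  obtain ⟨c⟩ := ‹Nonempty α›
  exact dist_eq_two_of_common_adj (w := Sum.inl c) (by simpa using h) (by simp) (by simp)
    (by simp)

variable [Fintype α] [Fintype β]

theorem kappaEq_completeBipartiteGraph_of_unique [Nonempty α] [Unique β] :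
    KappaEq (completeBipartiteGraph α β) (Fintype.card α) := by
  refine ⟨⟨{Sum.inr default}, ?_⟩, ?_⟩
  · refine isMARS_of_mrep_eq (m := {1}) (by simp) Fintype.card_pos (by simp) ?_
    rintro (a | b) hv
    · simp [mrep, completeBipartiteGraph_dist_inl_inr]
    · exact absurd (by simp [Subsingleton.elim b default]) hv
  · rintro k' hk' ⟨S, hS⟩
    have hle := hS.add_card_le
    have hpos := hS.1.card_pos
    simp only [Fintype.card_sum, Fintype.card_unique] at hle
    omega

theorem kappaEq_completeBipartiteGraph_of_nontrivial [Nontrivial α] [Nontrivial β] :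
    KappaEq (completeBipartiteGraph α β) (Fintype.card α + Fintype.card β - 2) := by
  classical
  have hα : 1 < Fintype.card α := Fintype.one_lt_card
  have hβ : 1 < Fintype.card β := Fintype.one_lt_card
  constructor
  · obtain ⟨a⟩ : Nonempty α := inferInstance
    obtain ⟨b⟩ : Nonempty β := inferInstance
    have hab : (Sum.inl a : α ⊕ β) ∉ ({Sum.inr b} : Finset (α ⊕ β)) := by simp
    refine ⟨cons (Sum.inl a) {Sum.inr b} hab, ?_⟩
    refine isMARS_of_mrep_eq (m := {1, 2}) (by simp) (by omega) ?_ ?_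
    · rw [card_cons, card_singleton, Fintype.card_sum]
      omega
    · rintro (x | y) hv
      · have hx : x ≠ a := by rintro rfl; simp at hv
        simp [mrep, completeBipartiteGraph_dist_inl_inr,
          completeBipartiteGraph_dist_inl_inl hx]
        exact Multiset.pair_comm 2 1
      · have hy : y ≠ b := by rintro rfl; simp at hv
        simp [mrep, completeBipartiteGraph_dist_inr_inl,
          completeBipartiteGraph_dist_inr_inr hy]
  · rintro k' hk' ⟨S, hS⟩
    have hle := hS.add_card_le
    have hpos := hS.1.card_pos
    rw [Fintype.card_sum] at hle
    have hone : S.card = 1 := by omega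
    obtain ⟨s, rfl⟩ := card_eq_one.mp hone
    have hge : Fintype.card (α ⊕ β) ≤ k' + ({s} : Finset (α ⊕ β)).card := by
      rw [Fintype.card_sum, hone]
      omega
    rcases s with a | b
    · obtain ⟨x, hx⟩ := exists_ne a
      obtain ⟨y⟩ : Nonempty β := inferInstance
      have := hS.mrep_eq hge (v := Sum.inl x) (w := Sum.inr y) (by simpa using hx) (by simp)
      simp [mrep, completeBipartiteGraph_dist_inl_inl hx,
        completeBipartiteGraph_dist_inr_inl] at this
    · obtain ⟨y, hy⟩ := exists_ne b
      obtain ⟨x⟩ : Nonempty α := inferInstance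
      have := hS.mrep_eq hge (v := Sum.inr y) (w := Sum.inl x) (by simpa using hy) (by simp)
      simp [mrep, completeBipartiteGraph_dist_inr_inr hy,
        completeBipartiteGraph_dist_inl_inr] at this

end


/-- for `r ≥ t ≥ 1` with `r + t ≥ 2`, if `t = 1` and `r ≥ 2` then
`κ(K_{r,t}) = r + t - 1`, and if `t ≥ 2` then `κ(K_{r,t}) = r + t - 2`. -/
theorem stmt3 (r t : ℕ) (ht : 1 ≤ t) (hrt : t ≤ r) (h2 : 2 ≤ r + t) :
    (t = 1 → 2 ≤ r → KappaEq (completeBipartiteGraph (Fin r) (Fin t)) (r + t - 1)) ∧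
    (2 ≤ t → KappaEq (completeBipartiteGraph (Fin r) (Fin t)) (r + t - 2)) := by
  constructor
  · rintro rfl hr
    have : Nonempty (Fin r) := ⟨⟨0, by omega⟩⟩
    simpa using kappaEq_completeBipartiteGraph_of_unique (α := Fin r) (β := Fin 1)
  · intro ht2
    have : Nontrivial (Fin r) := Fin.nontrivial_iff_two_le.mpr (by omega)
    have : Nontrivial (Fin t) := Fin.nontrivial_iff_two_le.mpr ht2
    simpa using kappaEq_completeBipartiteGraph_of_nontrivial (α := Fin r) (β := Fin t)
end

section
/- For every integer n ≥ 3, the path graph P_n satisfies κ(P_n) = 2; that is, P_n contains a 2-multiset antiresolving set, and every k-multiset antiresolving set of P_n satisfies k ≤ 2. -/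
open Finset

theorem pathGraph_natAbs_sub_le_length {n : ℕ} {u v : Fin n}
    (w : (SimpleGraph.pathGraph n).Walk u v) : ((u : ℤ) - v).natAbs ≤ w.length := by
  induction w with
  | nil => simp
  | cons h p ih =>
    rw [SimpleGraph.pathGraph_adj] at h
    rw [SimpleGraph.Walk.length_cons]
    omega

theorem pathGraph_dist_le_of_add_eq {n : ℕ} (d : ℕ) {u v : Fin n} (h : (u : ℕ) + d = v) :
    (SimpleGraph.pathGraph n).dist u v ≤ d := by
  induction d generalizing u with
  | zero => simp [show u = v from Fin.ext h]
  | succ d ih =>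
    have hlt : (u : ℕ) + 1 < n := by omega
    have hadj : (SimpleGraph.pathGraph n).Adj u ⟨u + 1, hlt⟩ :=
      SimpleGraph.pathGraph_adj.2 (Or.inl rfl)
    have hrest := ih (u := ⟨u + 1, hlt⟩) (by simp only; omega)
    obtain ⟨p, hp⟩ := (SimpleGraph.pathGraph_preconnected n
      (⟨u + 1, hlt⟩ : Fin n) v).exists_walk_length_eq_dist
    have := SimpleGraph.dist_le (SimpleGraph.Walk.cons hadj p)
    rw [SimpleGraph.Walk.length_cons] at this
    omega

theorem pathGraph_dist {n : ℕ} (u v : Fin n) :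
    (SimpleGraph.pathGraph n).dist u v = ((u : ℤ) - v).natAbs := by
  apply le_antisymm
  · rcases le_total (u : ℕ) v with h | h
    · exact (pathGraph_dist_le_of_add_eq (v - u : ℕ) (by omega)).trans (by omega)
    · rw [SimpleGraph.dist_comm]
      exact (pathGraph_dist_le_of_add_eq (u - v : ℕ) (by omega)).trans (by omega)
  · obtain ⟨p, hp⟩ := (SimpleGraph.pathGraph_preconnected n u v).exists_walk_length_eq_dist
    exact hp ▸ pathGraph_natAbs_sub_le_length p

theorem sum_sq_sub_eq_of_mrep_eq {n : ℕ} {S : Finset (Fin n)} {u v : Fin n}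
    (h : mrep (SimpleGraph.pathGraph n) S u = mrep (SimpleGraph.pathGraph n) S v) :
    ∑ s ∈ S, ((u : ℤ) - s) ^ 2 = ∑ s ∈ S, ((v : ℤ) - s) ^ 2 := by
  have := congrArg (fun m : Multiset ℕ => (m.map (fun d : ℕ => (d : ℤ) ^ 2)).sum) h
  simp only [mrep, pathGraph_dist, Multiset.map_map, Function.comp_def, Int.natCast_natAbs,
    sq_abs] at this
  exact this

theorem card_mul_add_eq_of_mrep_eq {n : ℕ} {S : Finset (Fin n)} {u v : Fin n} (huv : u ≠ v)
    (h : mrep (SimpleGraph.pathGraph n) S u = mrep (SimpleGraph.pathGraph n) S v) :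
    (#S : ℤ) * (u + v) = 2 * ∑ s ∈ S, (s : ℤ) := by
  have hsum := sum_sq_sub_eq_of_mrep_eq h
  simp only [sub_sq, Finset.sum_add_distrib, Finset.sum_sub_distrib, Finset.sum_const,
    nsmul_eq_mul, ← Finset.mul_sum] at hsum
  have hne : (u : ℤ) - v ≠ 0 := by
    have := Fin.val_ne_of_ne huv
    omega
  apply mul_left_cancel₀ hne
  linear_combination hsum

/-- The sum of the squared distances to `S` is a quadratic function of the vertex, so it takes
each value at most twice. -/
theorem card_mclass_pathGraph_le_two {n : ℕ} {S : Finset (Fin n)} (hS : S.Nonempty) (u : Fin n) :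
    #(mclass (SimpleGraph.pathGraph n) S u) ≤ 2 := by
  by_contra! hlt
  obtain ⟨a, ha, b, hb, c, hc, hab, hac, hbc⟩ := Finset.two_lt_card.1 hlt
  simp only [mclass, Finset.mem_filter, Finset.mem_univ, true_and] at ha hb hc
  have hb' := card_mul_add_eq_of_mrep_eq hab (ha.2.trans hb.2.symm)
  have hc' := card_mul_add_eq_of_mrep_eq hac (ha.2.trans hc.2.symm)
  have hcard : (#S : ℤ) ≠ 0 := by exact_mod_cast hS.card_pos.ne'
  have := mul_left_cancel₀ hcard (hb'.trans hc'.symm)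
  exact hbc (Fin.ext (by omega))

theorem mrep_pathGraph_rev {n : ℕ} {S : Finset (Fin n)} (hS : ∀ v, v.rev ∈ S ↔ v ∈ S)
    (u : Fin n) :
    mrep (SimpleGraph.pathGraph n) S u.rev = mrep (SimpleGraph.pathGraph n) S u := by
  have hmap : S.map Fin.revPerm.toEmbedding = S := by
    ext v
    simp [Finset.mem_map_equiv, hS]
  unfold mrep
  conv_lhs => rw [← hmap]
  rw [Finset.map_val, Multiset.map_map]
  refine Multiset.map_congr rfl fun s _ => ?_
  simp only [Function.comp_apply, Equiv.coe_toEmbedding, Fin.revPerm_apply, pathGraph_dist,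
    Fin.val_rev]
  omega

theorem two_le_card_mclass_pathGraph {n : ℕ} {S : Finset (Fin n)} (hS : ∀ v, v.rev ∈ S ↔ v ∈ S)
    {u : Fin n} (hu : u ∉ S) (hne : u ≠ u.rev) :
    2 ≤ #(mclass (SimpleGraph.pathGraph n) S u) := by
  rw [← Finset.card_pair hne]
  apply Finset.card_le_card
  intro v hv
  rw [Finset.mem_insert, Finset.mem_singleton] at hv
  rcases hv with rfl | rfl
  · simp [mclass, hu]
  · simp [mclass, hS, hu, mrep_pathGraph_rev hS u]

/-- The central vertices of a path form a `2`-multiset antiresolving set. -/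
theorem exists_isMARS_pathGraph_two {n : ℕ} (hn : 3 ≤ n) :
    ∃ S : Finset (Fin n), IsMARS (SimpleGraph.pathGraph n) S 2 := by
  let S : Finset (Fin n) := {v | (v : ℕ) ≤ v.rev + 1 ∧ (v.rev : ℕ) ≤ v + 1}
  have hmem (v : Fin n) : v ∈ S ↔ (v : ℕ) ≤ v.rev + 1 ∧ (v.rev : ℕ) ≤ v + 1 := by simp [S]
  have hS (v : Fin n) : v.rev ∈ S ↔ v ∈ S := by
    rw [hmem, hmem, Fin.rev_rev, and_comm]
  have hnonempty : S.Nonempty := by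
    refine ⟨⟨n / 2, by omega⟩, (hmem _).2 ?_⟩
    simp only [Fin.val_rev]
    omega
  have hcard (u : Fin n) (hu : u ∉ S) : #(mclass (SimpleGraph.pathGraph n) S u) = 2 := by
    refine le_antisymm (card_mclass_pathGraph_le_two hnonempty u)
      (two_le_card_mclass_pathGraph hS hu fun h => hu ?_)
    rw [hmem, ← h]
    omega
  have hzero : (⟨0, by omega⟩ : Fin n) ∉ S := by
    rw [hmem]
    simp only [Fin.val_rev]
    omega
  exact ⟨S, hnonempty, ⟨⟨0, by omega⟩, by simpa using hzero⟩, fun u hu => (hcard u hu).ge,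
    _, hzero, hcard _ hzero⟩

/-- for every `n ≥ 3`, `κ(P_n) = 2`: the path `P_n` contains a `2`-multiset
antiresolving set, and every `k`-multiset antiresolving set of `P_n` satisfies `k ≤ 2`. -/
theorem stmt4 (n : ℕ) (hn : 3 ≤ n) :
    (∃ S : Finset (Fin n), IsMARS (SimpleGraph.pathGraph n) S 2) ∧
    ∀ (k : ℕ) (S : Finset (Fin n)), IsMARS (SimpleGraph.pathGraph n) S k → k ≤ 2 := by
  refine ⟨exists_isMARS_pathGraph_two hn, ?_⟩
  rintro k S ⟨hS, -, -, u, -, rfl⟩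
  exact card_mclass_pathGraph_le_two hS u
end

section
/- Let r ≥ t be positive integers and let k = t. If r > t, then msad_t(K_{r,t}) = 1; if r = t, then msad_t(K_{r,t}) = r. That is, in the first case K_{r,t} has a t-multiset antiresolving set consisting of a single vertex, and in the second case K_{r,t} has a t-multiset antiresolving set of cardinality r and every t-multiset antiresolving set of K_{r,t} has cardinality at least r. -/
open Finset

/-- `msad_k(G) = m`: `G` has a `k`-multiset antiresolving set of cardinality `m`, and every
`k`-multiset antiresolving set of `G` has cardinality at least `m`. -/
def MsadEq {V : Type*} [Fintype V] (G : SimpleGraph V) (k m : ℕ) : Prop :=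
  (∃ S : Finset V, IsMARS G S k ∧ S.card = m) ∧
    ∀ S : Finset V, IsMARS G S k → m ≤ S.card

section CompleteBipartite

variable {α β : Type*}

theorem dist_inr_inl (b : β) (a : α) :
    (completeBipartiteGraph α β).dist (Sum.inr b) (Sum.inl a) = 1 :=
  SimpleGraph.dist_eq_one_iff_adj.2 (by simp [completeBipartiteGraph])

theorem dist_inl_inl [Nonempty β] {a a' : α} (h : a ≠ a') :
    (completeBipartiteGraph α β).dist (Sum.inl a) (Sum.inl a') = 2 := by
  obtain ⟨b⟩ := ‹Nonempty β›
  have h₁ : (completeBipartiteGraph α β).Adj (Sum.inl a) (Sum.inr b) := by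
    simp [completeBipartiteGraph]
  have h₂ : (completeBipartiteGraph α β).Adj (Sum.inr b) (Sum.inl a') := by
    simp [completeBipartiteGraph]
  have hreach := h₁.reachable.trans h₂.reachable
  have hle := SimpleGraph.dist_le (h₁.toWalk.append h₂.toWalk)
  have hpos := hreach.pos_dist_of_ne (by simpa using h)
  have hne : (completeBipartiteGraph α β).dist (Sum.inl a) (Sum.inl a') ≠ 1 := by
    rw [Ne, SimpleGraph.dist_eq_one_iff_adj]
    simp [completeBipartiteGraph]
  simp at hle
  omega

variable [Fintype α] [Fintype β]

theorem isMARS_singleton_inl [Nonempty β] (a : α) (h : Fintype.card β < Fintype.card α) :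
    IsMARS (completeBipartiteGraph α β) {Sum.inl a} (Fintype.card β) := by
  classical
  have hmem (u v : α ⊕ β) : v ∈ mclass (completeBipartiteGraph α β) {Sum.inl a} u ↔
      v ≠ Sum.inl a ∧ (completeBipartiteGraph α β).dist v (Sum.inl a) =
        (completeBipartiteGraph α β).dist u (Sum.inl a) := by
    simp [mclass, mrep]
  have hinr (b : β) : (mclass (completeBipartiteGraph α β) {Sum.inl a} (Sum.inr b)).card =
      Fintype.card β := by
    have : mclass (completeBipartiteGraph α β) {Sum.inl a} (Sum.inr b) =
        univ.map Function.Embedding.inr := by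
      ext (x | x)
      · rw [hmem]
        by_cases hx : x = a
        · simp [hx]
        · simp [dist_inl_inl hx, dist_inr_inl]
      · simp [hmem, dist_inr_inl]
    rw [this, card_map, card_univ]
  obtain ⟨b⟩ := ‹Nonempty β›
  refine ⟨singleton_nonempty _, ⟨Sum.inr b, by simp⟩, ?_, Sum.inr b, by simp, hinr b⟩
  rintro (x | x) hx
  · have hxa : x ≠ a := by simpa using hx
    have hsub : (univ.erase a).map Function.Embedding.inl ⊆
        mclass (completeBipartiteGraph α β) {Sum.inl a} (Sum.inl x) := by
      intro v hv
      simp only [mem_map, mem_erase, mem_univ, and_true] at hv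
      obtain ⟨y, hy, rfl⟩ := hv
      have : Nonempty β := ⟨b⟩
      simp [hmem, dist_inl_inl hxa, dist_inl_inl hy, hy]
    have hcard := card_le_card hsub
    rw [card_map, card_erase_of_mem (mem_univ a), card_univ] at hcard
    omega
  · exact (hinr x).ge

theorem isMARS_map_inl [Nonempty α] [Nonempty β] :
    IsMARS (completeBipartiteGraph α β) (univ.map Function.Embedding.inl) (Fintype.card β) := by
  classical
  have hinr (b : β) : (mclass (completeBipartiteGraph α β)
      (univ.map Function.Embedding.inl) (Sum.inr b)).card = Fintype.card β := by
    have : mclass (completeBipartiteGraph α β) (univ.map Function.Embedding.inl) (Sum.inr b) =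
        univ.map Function.Embedding.inr := by
      ext (x | x) <;> simp [mclass, mrep, dist_inr_inl]
    rw [this, card_map, card_univ]
  obtain ⟨b⟩ := ‹Nonempty β›
  refine ⟨univ_nonempty.map, ⟨Sum.inr b, by simp⟩, ?_, Sum.inr b, by simp, hinr b⟩
  rintro (x | x) hx
  · simp at hx
  · exact (hinr x).ge

end CompleteBipartite

/-- If one class of size `k` does not exhaust the complement of a `k`-MARS, the complement
contains a second, disjoint class; on at most `2 * k` vertices this is impossible. -/
theorem IsMARS.card_compl_le {V : Type*} [Fintype V] [DecidableEq V] {G : SimpleGraph V}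
    {S : Finset V} {k : ℕ} (h : IsMARS G S k) (hV : Fintype.card V ≤ 2 * k) : Sᶜ.card ≤ k := by
  obtain ⟨hne, -, hall, u, -, huk⟩ := h
  have hsub (w : V) : mclass G S w ⊆ Sᶜ := fun v hv => by
    simp only [mclass, mem_filter] at hv
    simpa using hv.2.1
  by_contra! hlt
  obtain ⟨w, hw, hwu⟩ := exists_mem_notMem_of_card_lt_card (huk.trans_lt hlt)
  have hwS : w ∉ S := by simpa using hw
  have hdisj : Disjoint (mclass G S u) (mclass G S w) := by
    rw [disjoint_left]
    intro v hvu hvw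
    simp only [mclass, mem_filter, mem_univ, true_and] at hvu hvw hwu
    exact hwu ⟨hwS, hvw.2.symm.trans hvu.2⟩
  have hunion := card_le_card (union_subset (hsub u) (hsub w))
  rw [card_union_of_disjoint hdisj] at hunion
  have := hall w hwS
  have := hne.card_pos
  have := card_add_card_compl S
  omega

/-- for `r ≥ t ≥ 1` and `k = t`: if `r > t` then `msad_t(K_{r,t}) = 1`, and
if `r = t` then `msad_t(K_{r,t}) = r`. -/
theorem stmt6 (r t : ℕ) (ht : 1 ≤ t) (hrt : t ≤ r) :
    (t < r → MsadEq (completeBipartiteGraph (Fin r) (Fin t)) t 1) ∧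
    (r = t → MsadEq (completeBipartiteGraph (Fin r) (Fin t)) t r) := by
  have : Nonempty (Fin t) := ⟨⟨0, ht⟩⟩
  have : Nonempty (Fin r) := ⟨⟨0, ht.trans hrt⟩⟩
  constructor
  · intro h
    refine ⟨⟨{Sum.inl (Classical.arbitrary _)}, ?_, card_singleton _⟩, fun S hS => hS.1.card_pos⟩
    simpa using isMARS_singleton_inl (β := Fin t) (Classical.arbitrary (Fin r)) (by simpa using h)
  · rintro rfl
    refine ⟨⟨univ.map Function.Embedding.inl, ?_, by simp⟩, fun S hS => ?_⟩
    · simpa using isMARS_map_inl (α := Fin r) (β := Fin r)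
    · have hle := hS.card_compl_le (by simp [two_mul])
      have hadd := card_add_card_compl S
      simp only [Fintype.card_sum, Fintype.card_fin] at hadd
      omega
end

section
/- Let r ≥ t be positive integers and let k be an integer with r < k ≤ r + t − 2 such that k and r + t have different parities (i.e., k ≢ r + t (mod 2)). Then K_{r,t} contains no k-multiset antiresolving set. -/
open Finset

theorem dist_completeBipartiteGraph_of_adj {α β : Type*} {x y : α ⊕ β}
    (h : x.isLeft ≠ y.isLeft) : (completeBipartiteGraph α β).dist x y = 1 := by
  rw [SimpleGraph.dist_eq_one_iff_adj]
  cases x <;> cases y <;> simp_all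

theorem dist_completeBipartiteGraph_of_not_adj {α β : Type*} [Nonempty α] [Nonempty β]
    {x y : α ⊕ β} (hne : x ≠ y) (h : x.isLeft = y.isLeft) :
    (completeBipartiteGraph α β).dist x y = 2 := by
  obtain ⟨z, hz⟩ : ∃ z : α ⊕ β, x.isLeft ≠ z.isLeft := by
    cases x
    · exact ⟨.inr (Classical.arbitrary β), by simp⟩
    · exact ⟨.inl (Classical.arbitrary α), by simp⟩
  have hxz : (completeBipartiteGraph α β).Adj x z :=
    SimpleGraph.dist_eq_one_iff_adj.mp (dist_completeBipartiteGraph_of_adj hz)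
  have hzy : (completeBipartiteGraph α β).Adj z y :=
    SimpleGraph.dist_eq_one_iff_adj.mp (dist_completeBipartiteGraph_of_adj (h ▸ hz.symm))
  have hle := SimpleGraph.dist_le (hxz.toWalk.append hzy.toWalk)
  have hpos := (hxz.reachable.trans hzy.reachable).pos_dist_of_ne hne
  have hna : (completeBipartiteGraph α β).dist x y ≠ 1 := by
    rw [Ne, SimpleGraph.dist_eq_one_iff_adj]
    cases x <;> cases y <;> simp_all
  simp only [SimpleGraph.Walk.length_append, SimpleGraph.Adj.length_toWalk] at hle
  omega

theorem mrep_completeBipartiteGraph {α β : Type*} [Nonempty α] [Nonempty β]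
    {S : Finset (α ⊕ β)} {x : α ⊕ β} (hx : x ∉ S) :
    mrep (completeBipartiteGraph α β) S x =
      S.val.map (fun s => if x.isLeft = s.isLeft then 2 else 1) := by
  refine Multiset.map_congr rfl fun s hs => ?_
  split_ifs with h
  · exact dist_completeBipartiteGraph_of_not_adj (fun e => hx (e ▸ hs)) h
  · exact dist_completeBipartiteGraph_of_adj h

theorem count_one_mrep_completeBipartiteGraph {α β : Type*} [Nonempty α] [Nonempty β]
    {S : Finset (α ⊕ β)} {x : α ⊕ β} (hx : x ∉ S) :
    (mrep (completeBipartiteGraph α β) S x).count 1 =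
      (S.filter (fun s => x.isLeft ≠ s.isLeft)).card := by
  rw [mrep_completeBipartiteGraph hx, Multiset.count_map, Finset.card, Finset.filter_val]
  congr 1
  refine Multiset.filter_congr fun s _ => ?_
  split_ifs with h <;> simp [h]

theorem mrep_completeBipartiteGraph_eq_of_isLeft_eq {α β : Type*} [Nonempty α] [Nonempty β]
    {S : Finset (α ⊕ β)} {x y : α ⊕ β} (hx : x ∉ S) (hy : y ∉ S) (h : x.isLeft = y.isLeft) :
    mrep (completeBipartiteGraph α β) S x = mrep (completeBipartiteGraph α β) S y := by
  rw [mrep_completeBipartiteGraph hx, mrep_completeBipartiteGraph hy, h]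

theorem even_card_of_mrep_completeBipartiteGraph_eq {α β : Type*} [Nonempty α] [Nonempty β]
    {S : Finset (α ⊕ β)} {x y : α ⊕ β} (hx : x ∉ S) (hy : y ∉ S) (h : x.isLeft ≠ y.isLeft)
    (heq : mrep (completeBipartiteGraph α β) S x = mrep (completeBipartiteGraph α β) S y) :
    Even S.card := by
  have hcount := congrArg (Multiset.count 1) heq
  rw [count_one_mrep_completeBipartiteGraph hx, count_one_mrep_completeBipartiteGraph hy] at hcount
  have hfilter : S.filter (fun s => y.isLeft ≠ s.isLeft) =
      S.filter (fun s => ¬ x.isLeft ≠ s.isLeft) := by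
    refine Finset.filter_congr fun s _ => ?_
    revert h
    cases x.isLeft <;> cases y.isLeft <;> cases s.isLeft <;> simp
  rw [hfilter] at hcount
  rw [← Finset.card_filter_add_card_filter_not (s := S) (fun s => x.isLeft ≠ s.isLeft), ← hcount]
  exact ⟨_, rfl⟩

theorem exists_isLeft_ne_of_card_lt {r t : ℕ} (hrt : t ≤ r) {A : Finset (Fin r ⊕ Fin t)}
    (hA : r < A.card) (x : Fin r ⊕ Fin t) : ∃ y ∈ A, x.isLeft ≠ y.isLeft := by
  by_contra! hall
  refine absurd hA (not_lt.mpr ?_)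
  cases x with
  | inl i =>
    have hsub : A ⊆ Finset.univ.map ⟨Sum.inl, Sum.inl_injective⟩ := by
      intro y hy
      have := hall y hy
      cases y <;> simp_all
    simpa using Finset.card_le_card hsub
  | inr j =>
    have hsub : A ⊆ Finset.univ.map ⟨Sum.inr, Sum.inr_injective⟩ := by
      intro y hy
      have := hall y hy
      cases y <;> simp_all
    exact le_trans (by simpa using Finset.card_le_card hsub) hrt

/-- for `r ≥ t ≥ 1` and `r < k ≤ r + t - 2` with `k ≢ r + t (mod 2)`,
`K_{r,t}` contains no `k`-multiset antiresolving set. -/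
theorem stmt9 (r t k : ℕ) (ht : 1 ≤ t) (hrt : t ≤ r) (hrk : r < k) (hk : k ≤ r + t - 2)
    (hpar : k % 2 ≠ (r + t) % 2) :
    ∀ S : Finset (Fin r ⊕ Fin t), ¬ IsMARS (completeBipartiteGraph (Fin r) (Fin t)) S k := by
  rintro S ⟨-, -, -, u, hu, hcard⟩
  have : Nonempty (Fin r) := ⟨⟨0, by omega⟩⟩
  have : Nonempty (Fin t) := ⟨⟨0, by omega⟩⟩
  obtain ⟨v, hv, huv⟩ := exists_isLeft_ne_of_card_lt hrt (hcard ▸ hrk) u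
  obtain ⟨hvS, hvu⟩ : v ∉ S ∧ mrep _ S v = mrep _ S u := by simpa [mclass] using hv
  have hclass : mclass (completeBipartiteGraph (Fin r) (Fin t)) S u = Sᶜ := by
    ext w
    simp only [mclass, Finset.mem_filter, Finset.mem_univ, true_and, Finset.mem_compl,
      and_iff_left_iff_imp]
    intro hw
    by_cases h : w.isLeft = u.isLeft
    · exact mrep_completeBipartiteGraph_eq_of_isLeft_eq hw hu h
    · refine (mrep_completeBipartiteGraph_eq_of_isLeft_eq hw hvS ?_).trans hvu
      revert h huv
      cases w.isLeft <;> cases u.isLeft <;> cases v.isLeft <;> simp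
  obtain ⟨a, ha⟩ := even_card_of_mrep_completeBipartiteGraph_eq hu hvS huv hvu.symm
  have hsum := Finset.card_add_card_compl S
  rw [← hclass, hcard, Fintype.card_sum, Fintype.card_fin, Fintype.card_fin] at hsum
  omega
end

section
/- Let T be a tree of diameter at least three, and let x, y ∈ V(T) be two non-adjacent vertices whose distance d(x,y) is odd. Then the set S = {x, y} is a k-multiset antiresolving set of T for some k ≤ 2; that is, S is a k-MARS for some k ∈ {1, 2}. -/
open Finset

theorem Multiset.pair_eq_pair_iff {α : Type*} {a b c d : α} :
    ({a, b} : Multiset α) = {c, d} ↔ a = c ∧ b = d ∨ a = d ∧ b = c := by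
  change Multiset.ofList [a, b] = Multiset.ofList [c, d] ↔ _
  simp [Multiset.coe_eq_coe, List.perm_pair]

/-- In an acyclic graph, at most one neighbour of `x` is closer to `y` than `x` is. -/
theorem SimpleGraph.IsAcyclic.eq_of_adj_of_dist_add_one_eq {V : Type*} {G : SimpleGraph V}
    (hG : G.IsAcyclic) (hc : G.Connected) {x y v w : V} (hv : G.Adj x v) (hw : G.Adj x w)
    (hvy : G.dist v y + 1 = G.dist x y) (hwy : G.dist w y + 1 = G.dist x y) : v = w := by
  obtain ⟨p, hp⟩ := hc.exists_walk_length_eq_dist v y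
  obtain ⟨q, hq⟩ := hc.exists_walk_length_eq_dist w y
  have hp' : (p.cons hv).IsPath :=
    SimpleGraph.Walk.isPath_of_length_eq_dist _ (by simp [hp, hvy])
  have hq' : (q.cons hw).IsPath :=
    SimpleGraph.Walk.isPath_of_length_eq_dist _ (by simp [hq, hwy])
  have h := congrArg (fun r : G.Path x y => r.1.snd)
    ((hG.subsingleton_path x y).elim ⟨_, hp'⟩ ⟨_, hq'⟩)
  simpa using h

/-- In a connected graph, each vertex `x` at positive distance from `y` has a neighbour closer
to `y`. -/
theorem SimpleGraph.Connected.exists_adj_dist_add_one_eq {V : Type*} {G : SimpleGraph V}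
    (hc : G.Connected) {x y : V} (hxy : x ≠ y) :
    ∃ v, G.Adj x v ∧ G.dist v y + 1 = G.dist x y := by
  obtain ⟨p, hp⟩ := hc.exists_walk_length_eq_dist x y
  cases p with
  | nil => exact absurd rfl hxy
  | cons h q =>
    refine ⟨_, h, ?_⟩
    have h₁ := SimpleGraph.dist_le q
    have h₂ := hc.dist_triangle (u := x) (w := y) (v := _) |>.trans
      (Nat.add_le_add_right (SimpleGraph.dist_eq_one_iff_adj.mpr h).le _)
    rw [SimpleGraph.Walk.length_cons] at hp
    omega

theorem mrep_pair {V : Type*} [DecidableEq V] (G : SimpleGraph V) {x y : V} (hxy : x ≠ y)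
    (v : V) : mrep G {x, y} v = {G.dist v x, G.dist v y} := by
  simp [mrep, hxy]

/-- A nonempty set with nonempty complement is a `k`-MARS for `k` the least size of a class, so
the size of any class bounds such a `k`. -/
theorem exists_isMARS_le {V : Type*} [Fintype V] (G : SimpleGraph V) {S : Finset V}
    (hS : S.Nonempty) {u : V} (hu : u ∉ S) : ∃ k ≤ (mclass G S u).card, IsMARS G S k := by
  classical
  obtain ⟨m, hm, hmin⟩ := Finset.exists_min_image Sᶜ (fun v => (mclass G S v).card)
    ⟨u, by simpa using hu⟩
  refine ⟨_, hmin u (by simpa using hu), hS, ⟨u, by simpa using hu⟩, ?_, m, by simpa using hm, rfl⟩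
  exact fun v hv => hmin v (by simpa using hv)

/-- in a tree `T` of diameter at least three, any two non-adjacent vertices
`x, y` at odd distance form a `k`-multiset antiresolving set for some `k ≤ 2`. -/
theorem stmt11 {V : Type*} [Fintype V] [DecidableEq V] (T : SimpleGraph V) (hT : T.IsTree)
    (hdiam : 3 ≤ T.diam) (x y : V) (hadj : ¬ T.Adj x y) (hodd : Odd (T.dist x y)) :
    ∃ k : ℕ, k ≤ 2 ∧ IsMARS T ({x, y} : Finset V) k := by
  have hxy : x ≠ y := by
    rintro rfl
    simp at hodd
  obtain ⟨a, hxa, hay⟩ := hT.connected.exists_adj_dist_add_one_eq hxy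
  obtain ⟨b, hyb, hbx⟩ := hT.connected.exists_adj_dist_add_one_eq hxy.symm
  have hax : T.dist a x = 1 := SimpleGraph.dist_eq_one_iff_adj.mpr hxa.symm
  have ha : a ∉ ({x, y} : Finset V) := by
    simp only [Finset.mem_insert, Finset.mem_singleton, not_or]
    refine ⟨hxa.ne', ?_⟩
    rintro rfl
    exact hadj hxa
  obtain ⟨k, hk, hS⟩ := exists_isMARS_le T (Finset.insert_nonempty x {y}) ha
  refine ⟨k, hk.trans ((Finset.card_le_card ?_).trans (Finset.card_le_two (a := a) (b := b))), hS⟩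
  intro v hv
  simp only [mclass, Finset.mem_filter, mrep_pair T hxy, hax] at hv
  have hv' : (T.dist v x = 1 ∧ T.dist v y = T.dist a y) ∨
      (T.dist v x = T.dist a y ∧ T.dist v y = 1) :=
    Multiset.pair_eq_pair_iff.mp hv.2.2
  simp only [Finset.mem_insert, Finset.mem_singleton]
  rcases hv' with ⟨h₁, h₂⟩ | ⟨h₁, h₂⟩
  · left
    exact hT.isAcyclic.eq_of_adj_of_dist_add_one_eq hT.connected
      (SimpleGraph.dist_eq_one_iff_adj.mp h₁).symm hxa (h₂ ▸ hay) hay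
  · right
    exact hT.isAcyclic.eq_of_adj_of_dist_add_one_eq hT.connected
      (SimpleGraph.dist_eq_one_iff_adj.mp h₂).symm hyb
      (by rw [h₁, hay, SimpleGraph.dist_comm]) hbx
end

section
/- For every tree T of diameter at least three, 1 ≤ msad_2(T) ≤ 2; that is, T contains a 2-multiset antiresolving set of cardinality at most 2. -/
open Finset

section TreeDistances

variable {V : Type*} {T : SimpleGraph V}

lemma SimpleGraph.IsTree.eq_of_adj_of_dist_lt (hT : T.IsTree) {x y z v : V} (hy : T.Adj x y)
    (hz : T.Adj x z) (hyv : T.dist x v = T.dist y v + 1) (hzv : T.dist x v = T.dist z v + 1) :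
    y = z := by
  obtain ⟨p, hp, hpl⟩ := hT.connected.exists_path_of_dist y v
  obtain ⟨q, hq, hql⟩ := hT.connected.exists_path_of_dist z v
  have hp' : (SimpleGraph.Walk.cons hy p).IsPath :=
    SimpleGraph.Walk.isPath_of_length_eq_dist _ (by simp [hpl, hyv])
  have hq' : (SimpleGraph.Walk.cons hz q).IsPath :=
    SimpleGraph.Walk.isPath_of_length_eq_dist _ (by simp [hql, hzv])
  have h := (hT.existsUnique_path x v).unique hp' hq'
  simpa using congrArg SimpleGraph.Walk.snd h

lemma SimpleGraph.IsTree.dist_eq_or_dist_eq (hT : T.IsTree) {x y : V} (hxy : T.Adj x y) (v : V) :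
    T.dist x v = T.dist y v + 1 ∨ T.dist y v = T.dist x v + 1 := by
  have := hT.dist_eq_dist_add_one_of_adj v hxy
  rwa [T.dist_comm (u := v), T.dist_comm (u := v)] at this

lemma SimpleGraph.IsTree.dist_eq_succ_of_ne (hT : T.IsTree) {x y z v : V} (hy : T.Adj x y)
    (hz : T.Adj x z) (hne : y ≠ z) (hyv : T.dist x v = T.dist y v + 1) :
    T.dist z v = T.dist x v + 1 :=
  (hT.dist_eq_or_dist_eq hz v).resolve_left fun h => hne (hT.eq_of_adj_of_dist_lt hy hz hyv h)

lemma SimpleGraph.IsTree.exists_adj_dist_lt (hT : T.IsTree) {x v : V} (hne : x ≠ v) :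
    ∃ y, T.Adj x y ∧ T.dist x v = T.dist y v + 1 := by
  obtain ⟨p, hpl⟩ := hT.connected.exists_walk_length_eq_dist x v
  cases p with
  | nil => exact absurd rfl hne
  | @cons _ y _ h p =>
    refine ⟨y, h, (hT.dist_eq_or_dist_eq h v).resolve_right fun h' => ?_⟩
    have := T.dist_le p
    simp only [SimpleGraph.Walk.length_cons] at hpl
    omega

lemma SimpleGraph.IsTree.dist_path_cases (hT : T.IsTree) {u a b v : V} (hua : T.Adj u a)
    (hab : T.Adj a b) (hbv : T.Adj b v) (hub : u ≠ b) (hav : a ≠ v) (w : V) :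
    (T.dist a w = T.dist u w + 1 ∧ T.dist b w = T.dist u w + 2 ∧ T.dist v w = T.dist u w + 3) ∨
    (T.dist u w = T.dist a w + 1 ∧ T.dist b w = T.dist a w + 1 ∧ T.dist v w = T.dist a w + 2) ∨
    (T.dist v w = T.dist b w + 1 ∧ T.dist a w = T.dist b w + 1 ∧ T.dist u w = T.dist b w + 2) ∨
    (T.dist b w = T.dist v w + 1 ∧ T.dist a w = T.dist v w + 2 ∧
      T.dist u w = T.dist v w + 3) := by
  have h1 := hT.dist_eq_or_dist_eq hua w
  have h2 := hT.dist_eq_or_dist_eq hab w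
  have h3 := hT.dist_eq_or_dist_eq hbv w
  have h4 := fun h => hT.dist_eq_succ_of_ne (v := w) hua.symm hab hub h
  have h5 := fun h => hT.dist_eq_succ_of_ne (v := w) hab.symm hbv hav h
  omega

end TreeDistances

section Counting

variable {V : Type*} [Fintype V]

open scoped Classical in
/-- The number of vertices at distance `h` from `x`. -/
noncomputable def layerCard (T : SimpleGraph V) (x : V) (h : ℕ) : ℕ :=
  #{v | T.dist x v = h}

open scoped Classical in
/-- For an edge `xy` of a tree, the number of vertices on the side of `x` at distance `h`
from `x`. -/
noncomputable def sideCard (T : SimpleGraph V) (x y : V) (h : ℕ) : ℕ :=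
  #{v | T.dist x v = h ∧ T.dist y v = h + 1}

variable {T : SimpleGraph V}

lemma sideCard_zero (hT : T.IsTree) {x y : V} (hxy : T.Adj x y) : sideCard T x y 0 = 1 := by
  classical
  rw [sideCard, Finset.card_eq_one]
  refine ⟨x, ?_⟩
  ext v
  simp only [mem_filter, mem_univ, true_and, mem_singleton, hT.connected.dist_eq_zero_iff]
  constructor
  · rintro ⟨h, -⟩; exact h.symm
  · rintro rfl
    exact ⟨rfl, by simpa using hxy.symm⟩

open scoped Classical in
lemma layerCard_succ (hT : T.IsTree) (x : V) (h : ℕ) :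
    layerCard T x (h + 1) = ∑ z ∈ T.neighborFinset x, sideCard T z x h := by
  simp only [layerCard, sideCard]
  rw [← Finset.card_biUnion]
  · congr 1
    ext v
    simp only [mem_filter, mem_univ, true_and, mem_biUnion, SimpleGraph.mem_neighborFinset]
    constructor
    · intro hv
      obtain ⟨y, hy, hyv⟩ := hT.exists_adj_dist_lt (x := x) (v := v)
        (by rintro rfl; simp at hv)
      exact ⟨y, hy, by omega, hv⟩
    · rintro ⟨z, -, -, h⟩
      exact h
  · intro y hy z hz hne
    rw [Function.onFun, Finset.disjoint_left]
    intro v hv hv'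
    simp only [mem_filter, mem_univ, true_and, mem_coe, SimpleGraph.mem_neighborFinset] at *
    exact hne (hT.eq_of_adj_of_dist_lt hy hz (v := v) (by omega) (by omega))

lemma layerCard_eq (hT : T.IsTree) {x y : V} (hxy : T.Adj x y) (h : ℕ) :
    layerCard T x (h + 1) = sideCard T x y (h + 1) + sideCard T y x h := by
  classical
  simp only [layerCard, sideCard]
  rw [← Finset.card_union_of_disjoint]
  · congr 1
    ext v
    simp only [mem_filter, mem_univ, true_and, mem_union]
    have := hT.dist_eq_or_dist_eq hxy v
    omega
  · rw [Finset.disjoint_left]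
    intro v hv hv'
    simp only [mem_filter, mem_univ, true_and] at *
    omega

open scoped Classical in
lemma sideCard_succ (hT : T.IsTree) {x y : V} (hxy : T.Adj x y) (h : ℕ) :
    sideCard T x y (h + 1) = ∑ z ∈ (T.neighborFinset x).erase y, sideCard T z x h := by
  have h1 := layerCard_eq hT hxy h
  rw [layerCard_succ hT, ← Finset.add_sum_erase _ _ (a := y) (by simpa using hxy)] at h1
  omega

lemma sideCard_pos_of_succ (hT : T.IsTree) (h : ℕ) : ∀ {x y : V}, T.Adj x y →
    0 < sideCard T x y (h + 1) → 0 < sideCard T x y h := by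
  classical
  induction h with
  | zero => intro x y hxy _; simp [sideCard_zero hT hxy]
  | succ h ih =>
    intro x y hxy hpos
    rw [sideCard_succ hT hxy] at hpos ⊢
    obtain ⟨z, hz, hzp⟩ := Finset.sum_pos_iff.1 hpos
    refine Finset.sum_pos_iff.2 ⟨z, hz, ih ?_ hzp⟩
    simp only [mem_erase, SimpleGraph.mem_neighborFinset] at hz
    exact hz.2.symm

lemma sideCard_le_sideCard (hT : T.IsTree) {x y z : V} (hxy : T.Adj x y) (hxz : T.Adj x z)
    (hne : y ≠ z) (h : ℕ) : sideCard T z x h ≤ sideCard T x y (h + 1) := by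
  classical
  rw [sideCard_succ hT hxy]
  exact Finset.single_le_sum (f := fun z => sideCard T z x h) (fun _ _ => Nat.zero_le _)
    (by simp [hxz, hne.symm])

lemma sideCard_add_le_sideCard (hT : T.IsTree) {x y z w : V} (hxy : T.Adj x y)
    (hxz : T.Adj x z) (hxw : T.Adj x w) (hyz : y ≠ z) (hyw : y ≠ w) (hzw : z ≠ w) (h : ℕ) :
    sideCard T z x h + sideCard T w x h ≤ sideCard T x y (h + 1) := by
  classical
  rw [sideCard_succ hT hxy, ← Finset.sum_pair (f := fun z => sideCard T z x h) hzw]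
  refine Finset.sum_le_sum_of_subset fun a ha => ?_
  simp only [mem_insert, mem_singleton] at ha
  rcases ha with rfl | rfl
  · simp [hxz, hyz.symm]
  · simp [hxw, hyw.symm]

lemma exists_sideCard_pos_iff (hT : T.IsTree) (x y : V) : ∃ m, T.Adj x y →
    ∀ h, 0 < sideCard T y x h ↔ h ≤ m := by
  classical
  by_cases hxy : T.Adj x y
  swap
  · exact ⟨0, fun h => absurd h hxy⟩
  have hex : ∃ h, sideCard T y x h = 0 := by
    refine ⟨univ.sup (T.dist y) + 1, ?_⟩
    rw [sideCard, Finset.card_eq_zero, Finset.filter_eq_empty_iff]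
    rintro v - ⟨hv, -⟩
    have := Finset.le_sup (f := T.dist y) (mem_univ v)
    omega
  have h0 := sideCard_zero hT hxy.symm
  have hf : Nat.find hex ≠ 0 := fun h => by have := Nat.find_spec hex; rw [h] at this; omega
  refine ⟨Nat.find hex - 1, fun _ h => ⟨fun hp => ?_, fun hle => ?_⟩⟩
  · by_contra hlt
    have : ∀ k, sideCard T y x (Nat.find hex + k) = 0 := by
      intro k
      induction k with
      | zero => exact Nat.find_spec hex
      | succ k ih =>
        by_contra hk
        have := sideCard_pos_of_succ hT (Nat.find hex + k) hxy.symm (Nat.pos_of_ne_zero hk)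
        exact this.ne' ih
    have := this (h - Nat.find hex)
    rw [Nat.add_sub_cancel' (by omega)] at this
    omega
  · exact Nat.pos_of_ne_zero (Nat.find_min hex (by omega))

/-- For an edge `xy` of a tree, the largest distance from `y` to a vertex on the side of `y`. -/
noncomputable def sideDepth (hT : T.IsTree) (x y : V) : ℕ :=
  (exists_sideCard_pos_iff hT x y).choose

lemma sideCard_pos_iff (hT : T.IsTree) {x y : V} (hxy : T.Adj x y) (h : ℕ) :
    0 < sideCard T y x h ↔ h ≤ sideDepth hT x y :=
  (exists_sideCard_pos_iff hT x y).choose_spec hxy h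

end Counting

lemma mrep_pair_eq_iff {V : Type*} [DecidableEq V] {T : SimpleGraph V} {x y u v : V}
    (hxy : x ≠ y) :
    mrep T {x, y} v = mrep T {x, y} u ↔
      (T.dist x v = T.dist x u ∧ T.dist y v = T.dist y u) ∨
      (T.dist x v = T.dist y u ∧ T.dist y v = T.dist x u) := by
  have h : ∀ w, mrep T {x, y} w = {T.dist x w, T.dist y w} := by
    intro w
    rw [mrep, Finset.insert_val_of_notMem (by simpa using hxy)]
    simp [T.dist_comm (u := w)]
  rw [h, h]
  constructor
  · intro h
    rcases Multiset.cons_eq_cons.1 h with ⟨h1, h2⟩ | ⟨h1, cs, h2, h3⟩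
    · exact .inl ⟨h1, by simpa using h2⟩
    · obtain ⟨h4, rfl⟩ := (Multiset.singleton_eq_cons_iff _).1 h2
      exact .inr ⟨((Multiset.singleton_eq_cons_iff _).1 h3).1.symm, h4⟩
  · rintro (⟨h1, h2⟩ | ⟨h1, h2⟩)
    · rw [h1, h2]
    · rw [h1, h2, Multiset.pair_comm]

section AntiresolvingSets

variable {V : Type*} [Fintype V] {T : SimpleGraph V}

/-- `T` has no `2`-multiset antiresolving set with at most two elements. -/
def NoSmallMARS (T : SimpleGraph V) : Prop :=
  ∀ S : Finset V, S.card ≤ 2 → ¬ IsMARS T S 2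

lemma NoSmallMARS.exists_card_eq_one (hN : NoSmallMARS T) {S : Finset V} (hS : S.Nonempty)
    (hS2 : S.card ≤ 2) {u : V} (hu : u ∉ S) (hu2 : (mclass T S u).card = 2) :
    ∃ w ∉ S, (mclass T S w).card = 1 := by
  classical
  by_contra! h
  refine hN S hS2 ⟨hS, ⟨u, by simpa using hu⟩, fun w hw => ?_, u, hu, hu2⟩
  have hpos : 0 < (mclass T S w).card := Finset.card_pos.2 ⟨w, by simp [mclass, hw]⟩
  have := h w hw
  omega

lemma card_mclass_singleton (hT : T.IsTree) {x u : V} (hu : u ∉ ({x} : Finset V)) :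
    (mclass T {x} u).card = layerCard T x (T.dist x u) := by
  classical
  simp only [mclass, layerCard]
  congr 1
  ext v
  simp only [mem_filter, mem_univ, true_and, mem_singleton, mrep, Finset.singleton_val,
    Multiset.map_singleton, Multiset.singleton_inj, T.dist_comm (v := x)] at *
  constructor
  · exact fun h => h.2
  · intro h
    refine ⟨fun hv => hu ?_, h⟩
    rw [hv, SimpleGraph.dist_self, eq_comm, hT.connected.dist_eq_zero_iff] at h
    exact h.symm

/-- Every nonempty layer around `x`, apart from `x` itself, has at least three vertices. -/
def VertexRich (T : SimpleGraph V) (x : V) : Prop :=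
  ∀ h, layerCard T x (h + 1) = 0 ∨ 3 ≤ layerCard T x (h + 1)

/-- Every nonempty layer around the edge `xy`, apart from the edge itself, has at least three
vertices. -/
def EdgeRich (T : SimpleGraph V) (x y : V) : Prop :=
  ∀ h, sideCard T x y (h + 1) + sideCard T y x (h + 1) = 0 ∨
    3 ≤ sideCard T x y (h + 1) + sideCard T y x (h + 1)

lemma EdgeRich.symm {x y : V} (h : EdgeRich T x y) : EdgeRich T y x := fun k => by
  have := h k
  omega

lemma NoSmallMARS.vertexRich (hN : NoSmallMARS T) (hT : T.IsTree) {x : V}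
    (h : ∀ h, layerCard T x (h + 1) ≠ 1) : VertexRich T x := by
  classical
  intro k
  by_contra hk
  have h2 : layerCard T x (k + 1) = 2 := by have := h k; omega
  have hpos : 0 < layerCard T x (k + 1) := by omega
  obtain ⟨u, hu⟩ := Finset.card_pos.1 hpos
  simp only [mem_filter, mem_univ, true_and] at hu
  have hux : u ∉ ({x} : Finset V) := by
    rw [mem_singleton]; rintro rfl; simp at hu
  obtain ⟨w, hw, hw1⟩ := hN.exists_card_eq_one (singleton_nonempty x) (by simp) hux
    (by rw [card_mclass_singleton hT hux, hu, h2])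
  rw [card_mclass_singleton hT hw] at hw1
  rw [mem_singleton] at hw
  have := hT.connected.pos_dist_of_ne (Ne.symm hw)
  exact h (T.dist x w - 1) (by rwa [Nat.sub_add_cancel this])

lemma card_mclass_edge {x y u : V} [DecidableEq V] (hxy : T.Adj x y) {h : ℕ}
    (hu : T.dist x u = h + 1 ∧ T.dist y u = h + 2 ∨ T.dist y u = h + 1 ∧ T.dist x u = h + 2) :
    (mclass T {x, y} u).card = sideCard T x y (h + 1) + sideCard T y x (h + 1) := by
  classical
  simp only [sideCard]
  rw [← Finset.card_union_of_disjoint]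
  · simp only [mclass]
    congr 1
    ext v
    simp only [mem_filter, mem_univ, true_and, mem_union, mem_insert, mem_singleton,
      mrep_pair_eq_iff hxy.ne]
    constructor
    · rintro ⟨-, h1⟩
      omega
    · refine fun h1 => ⟨?_, by omega⟩
      rintro (rfl | rfl)
      · simp at h1
      · simp at h1
  · rw [Finset.disjoint_left]
    intro v hv hv'
    simp only [mem_filter, mem_univ, true_and] at *
    omega

lemma NoSmallMARS.edgeRich (hN : NoSmallMARS T) (hT : T.IsTree) {x y : V} (hxy : T.Adj x y)
    (h : ∀ h, sideCard T x y (h + 1) + sideCard T y x (h + 1) ≠ 1) : EdgeRich T x y := by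
  classical
  intro k
  by_contra hk
  have h2 : sideCard T x y (k + 1) + sideCard T y x (k + 1) = 2 := by have := h k; omega
  obtain ⟨u, hu⟩ : ∃ u, T.dist x u = k + 1 ∧ T.dist y u = k + 2 ∨
      T.dist y u = k + 1 ∧ T.dist x u = k + 2 := by
    have : 0 < sideCard T x y (k + 1) ∨ 0 < sideCard T y x (k + 1) := by omega
    rcases this with hp | hp
    · obtain ⟨u, hu⟩ := Finset.card_pos.1 hp
      simp only [mem_filter, mem_univ, true_and] at hu
      exact ⟨u, .inl hu⟩
    · obtain ⟨u, hu⟩ := Finset.card_pos.1 hp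
      simp only [mem_filter, mem_univ, true_and] at hu
      exact ⟨u, .inr hu⟩
  have hux : u ∉ ({x, y} : Finset V) := by
    simp only [mem_insert, mem_singleton]
    rintro (rfl | rfl) <;> simp at hu
  obtain ⟨w, hw, hw1⟩ := hN.exists_card_eq_one (insert_nonempty x {y}) (card_le_two) hux
    (by rw [card_mclass_edge hxy hu, h2])
  simp only [mem_insert, mem_singleton, not_or] at hw
  have hx := hT.connected.pos_dist_of_ne (Ne.symm hw.1)
  have hy := hT.connected.pos_dist_of_ne (Ne.symm hw.2)
  obtain hd | hd := hT.dist_eq_or_dist_eq hxy w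
  · rw [card_mclass_edge hxy (h := T.dist y w - 1) (by omega)] at hw1
    exact h _ hw1
  · rw [card_mclass_edge hxy (h := T.dist x w - 1) (by omega)] at hw1
    exact h _ hw1

lemma sideCard_succ_eq_card_add (hT : T.IsTree) {u a b v : V} (hua : T.Adj u a)
    (hab : T.Adj a b) (hbv : T.Adj b v) (hub : u ≠ b) (hav : a ≠ v) (h : ℕ) :
    sideCard T a b (h + 1) =
      #{w | T.dist u w = h + 2 ∧ T.dist v w = h + 3} + sideCard T u a h := by
  classical
  simp only [sideCard]
  rw [← Finset.card_union_of_disjoint]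
  · congr 1
    ext w
    have := hT.dist_path_cases hua hab hbv hub hav w
    simp only [mem_filter, mem_univ, true_and, mem_union]
    omega
  · rw [Finset.disjoint_left]
    intro w hw hw'
    simp only [mem_filter, mem_univ, true_and] at *
    omega

lemma NoSmallMARS.false_of_path (hN : NoSmallMARS T) (hT : T.IsTree) {u a b v : V}
    (hua : T.Adj u a) (hab : T.Adj a b) (hbv : T.Adj b v) (hub : u ≠ b) (hav : a ≠ v)
    (hends : ∀ h, sideCard T u a (h + 1) + sideCard T v b (h + 1) ≠ 1)
    (hmid : ∀ h, sideCard T a b (h + 1) + sideCard T b a (h + 1) ≠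
      sideCard T u a h + sideCard T v b h + 1) : False := by
  classical
  have hcases := hT.dist_path_cases hua hab hbv hub hav
  have huv : u ≠ v := by
    rintro rfl
    have := hcases u
    simp at this
  have hdua : T.dist u a = 1 := by simpa using hua
  have hdva : T.dist v a = 2 := by
    have h1 := hcases a
    simp only [SimpleGraph.dist_self] at h1
    omega
  have ha : a ∉ ({u, v} : Finset V) := by simp [hua.ne', hav]
  have hdub : T.dist u b = 2 := by
    have h1 := hcases b
    simp only [SimpleGraph.dist_self] at h1
    omega
  have hdvb : T.dist v b = 1 := by simpa using hbv.symm
  have ha2 : (mclass T {u, v} a).card = 2 := by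
    rw [Finset.card_eq_two]
    refine ⟨a, b, hab.ne, ?_⟩
    ext w
    simp only [mclass, mem_filter, mem_univ, true_and, mem_insert, mem_singleton,
      mrep_pair_eq_iff huv, hdua, hdva]
    constructor
    · rintro ⟨-, h⟩
      have := hcases w
      rw [eq_comm, ← hT.connected.dist_eq_zero_iff, eq_comm (a := w),
        ← hT.connected.dist_eq_zero_iff]
      omega
    · rintro (rfl | rfl)
      · simp_all
      · simp [hdub, hdvb, hub.symm, hbv.ne]
  obtain ⟨w, hw, hw1⟩ := hN.exists_card_eq_one (insert_nonempty u {v}) card_le_two ha ha2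
  simp only [mem_insert, mem_singleton, not_or] at hw
  have hu0 := hT.connected.pos_dist_of_ne (Ne.symm hw.1)
  have hv0 := hT.connected.pos_dist_of_ne (Ne.symm hw.2)
  have hend : ∀ h, (T.dist u w = h + 1 ∧ T.dist v w = h + 4 ∨
      T.dist v w = h + 1 ∧ T.dist u w = h + 4) → False := by
    intro h hh
    refine hends h (Eq.trans ?_ hw1)
    simp only [sideCard]
    rw [← Finset.card_union_of_disjoint]
    · simp only [mclass]
      congr 1
      ext z
      have := hcases z
      simp only [mem_filter, mem_univ, true_and, mem_union, mem_insert, mem_singleton,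
        mrep_pair_eq_iff huv]
      constructor
      · intro h1
        refine ⟨?_, by omega⟩
        rintro (rfl | rfl) <;> simp only [SimpleGraph.dist_self] at h1 this <;> omega
      · rintro ⟨-, h1⟩
        omega
    · rw [Finset.disjoint_left]
      intro z hz hz'
      have := hcases z
      simp only [mem_filter, mem_univ, true_and] at *
      omega
  have hinner : ∀ h, (T.dist u w = h + 2 ∧ T.dist v w = h + 3 ∨
      T.dist v w = h + 2 ∧ T.dist u w = h + 3) → False := by
    intro h hh
    apply hmid h
    have hcard : #{z | T.dist u z = h + 2 ∧ T.dist v z = h + 3} +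
        #{z | T.dist v z = h + 2 ∧ T.dist u z = h + 3} = 1 := by
      refine Eq.trans ?_ hw1
      rw [← Finset.card_union_of_disjoint]
      · simp only [mclass]
        congr 1
        ext z
        simp only [mem_filter, mem_univ, true_and, mem_union, mem_insert, mem_singleton,
          mrep_pair_eq_iff huv]
        constructor
        · intro h1
          refine ⟨?_, by omega⟩
          rintro (rfl | rfl) <;> simp at h1
        · rintro ⟨-, h1⟩
          omega
      · rw [Finset.disjoint_left]
        intro z hz hz'
        simp only [mem_filter, mem_univ, true_and] at *
        omega
    rw [sideCard_succ_eq_card_add hT hua hab hbv hub hav,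
      sideCard_succ_eq_card_add hT hbv.symm hab.symm hua.symm hav.symm hub.symm]
    omega
  rcases hcases w with h | h | h | h
  · exact hend (T.dist u w - 1) (by omega)
  · by_cases h0 : T.dist a w = 0
    · rw [hT.connected.dist_eq_zero_iff] at h0
      subst h0
      omega
    · exact hinner (T.dist a w - 1) (by omega)
  · by_cases h0 : T.dist b w = 0
    · rw [hT.connected.dist_eq_zero_iff] at h0
      subst h0
      have : mclass T {u, v} b = mclass T {u, v} a := by
        have hm : mrep T {u, v} b = mrep T {u, v} a :=
          (mrep_pair_eq_iff huv).2 (.inr ⟨by omega, by omega⟩)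
        simp only [mclass, hm]
      rw [this] at hw1
      omega
    · exact hinner (T.dist b w - 1) (by omega)
  · exact hend (T.dist v w - 1) (by omega)

end AntiresolvingSets

section RichVertices

variable {V : Type*} [Fintype V] {T : SimpleGraph V}

lemma sideCard_eq_zero_of_le (hT : T.IsTree) {x y : V} (hxy : T.Adj x y) {h k : ℕ}
    (hhk : h ≤ k) (h0 : sideCard T x y h = 0) : sideCard T x y k = 0 := by
  by_contra hk
  have := (sideCard_pos_iff hT hxy.symm k).1 (Nat.pos_of_ne_zero hk)
  have := (sideCard_pos_iff hT hxy.symm h).2 (hhk.trans this)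
  omega

/-- The vertex `x` is adjacent to a leaf. -/
def HasLeafNeighbor (T : SimpleGraph V) (x : V) : Prop :=
  ∃ u, T.Adj x u ∧ sideCard T u x 1 = 0

lemma VertexRich.two_le_sideCard_one {x y : V} (hx : VertexRich T x) (hT : T.IsTree)
    (hxy : T.Adj x y) : 2 ≤ sideCard T x y 1 := by
  have h1 := layerCard_eq hT hxy 0
  have h2 := sideCard_zero hT hxy.symm
  have := hx 0
  simp only [zero_add] at *
  omega

lemma NoSmallMARS.not_hasLeafNeighbor (hN : NoSmallMARS T) (hT : T.IsTree) {x y : V}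
    (hxy : T.Adj x y) (hx : VertexRich T x) (hy : VertexRich T y) (he : EdgeRich T x y)
    (hlx : HasLeafNeighbor T x) : ¬ HasLeafNeighbor T y := by
  rintro ⟨v, hyv, hv⟩
  obtain ⟨u, hxu, hu⟩ := hlx
  have h1 := hx.two_le_sideCard_one hT hxy
  have h2 := hy.two_le_sideCard_one hT hxy.symm
  have hu' := fun h => sideCard_eq_zero_of_le hT hxu.symm (Nat.le_add_left 1 h) hu
  have hv' := fun h => sideCard_eq_zero_of_le hT hyv.symm (Nat.le_add_left 1 h) hv
  refine hN.false_of_path hT hxu.symm hxy hyv ?_ ?_ (fun h => ?_) (fun h => ?_)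
  · rintro rfl; omega
  · rintro rfl; omega
  · simp [hu', hv']
  · cases h with
    | zero =>
      rw [sideCard_zero hT hxu.symm, sideCard_zero hT hyv.symm, zero_add]
      omega
    | succ h =>
      have := he (h + 1)
      rw [hu', hv']
      omega

lemma VertexRich.exists_leaf_of_sideCard_two_eq_zero {a p : V} (ha : VertexRich T a)
    (hT : T.IsTree) (hap : T.Adj a p) (h : sideCard T a p 2 = 0) :
    ∃ u, T.Adj a u ∧ u ≠ p ∧ sideCard T u a 1 = 0 := by
  classical
  have h1 := ha.two_le_sideCard_one hT hap
  rw [sideCard_succ hT hap] at h1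
  obtain ⟨u, hu, -⟩ := Finset.sum_pos_iff.1 (lt_of_lt_of_le Nat.zero_lt_two h1)
  simp only [mem_erase, SimpleGraph.mem_neighborFinset] at hu
  have := sideCard_le_sideCard hT hap hu.2 hu.1.symm 1
  exact ⟨u, hu.2, hu.1, Nat.le_zero.1 (this.trans_eq h)⟩

lemma VertexRich.three_le_sideCard_one {a p : V} (ha : VertexRich T a) (hp : VertexRich T p)
    (hT : T.IsTree) (hap : T.Adj a p) (h : sideCard T a p 2 = 0) : 3 ≤ sideCard T p a 1 := by
  have := layerCard_eq hT hap 1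
  have := ha 1
  have := hp.two_le_sideCard_one hT hap.symm
  simp only [Nat.reduceAdd] at *
  omega

lemma NoSmallMARS.hasLeafNeighbor_of_stars (hN : NoSmallMARS T) (hT : T.IsTree) {a p w : V}
    (hap : T.Adj a p) (hpw : T.Adj p w) (haw : a ≠ w) (ha : VertexRich T a)
    (hp : VertexRich T p) (ha2 : sideCard T a p 2 = 0) (hw1 : 2 ≤ sideCard T w p 1)
    (hw2 : sideCard T w p 2 = 0) : HasLeafNeighbor T p := by
  classical
  by_contra hl
  obtain ⟨u, hau, hup, hu⟩ := ha.exists_leaf_of_sideCard_two_eq_zero hT hap ha2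
  have hu' := fun h => sideCard_eq_zero_of_le hT hau.symm (Nat.le_add_left 1 h) hu
  have hw' := fun h => sideCard_eq_zero_of_le hT hpw.symm (Nat.le_add_left 2 h) hw2
  have ha' := fun h => sideCard_eq_zero_of_le hT hap (Nat.le_add_left 2 h) ha2
  have h1 := ha.two_le_sideCard_one hT hap
  have h2 := ha.three_le_sideCard_one hp hT hap ha2
  have h3 : sideCard T w p 1 + 2 ≤ sideCard T p a 2 := by
    have hmem : w ∈ (T.neighborFinset p).erase a := by simp [hpw, haw.symm]
    rw [sideCard_succ hT hap.symm, ← Finset.add_sum_erase _ _ hmem] at h2 ⊢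
    have hle : ∑ z ∈ ((T.neighborFinset p).erase a).erase w, sideCard T z p 0 ≤
        ∑ z ∈ ((T.neighborFinset p).erase a).erase w, sideCard T z p 1 := by
      refine Finset.sum_le_sum fun z hz => ?_
      simp only [mem_erase, SimpleGraph.mem_neighborFinset] at hz
      rw [sideCard_zero hT hz.2.2.symm]
      by_contra hz1
      exact hl ⟨z, hz.2.2, by omega⟩
    rw [sideCard_zero hT hpw.symm] at h2
    omega
  refine hN.false_of_path hT hau.symm hap hpw hup haw (fun h => ?_) (fun h => ?_)
  · rw [hu']
    cases h with
    | zero => simp only [zero_add]; omega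
    | succ h => simp [hw']
  · match h with
    | 0 =>
      rw [sideCard_zero hT hau.symm, sideCard_zero hT hpw.symm, zero_add]
      omega
    | 1 =>
      simp only [Nat.reduceAdd]
      omega
    | h + 2 =>
      have := ha (h + 3)
      rw [layerCard_eq hT hap, ha'] at this
      rw [hu' (h + 1), hw', ha' (h + 1)]
      simp only [Nat.add_assoc, Nat.reduceAdd] at *
      omega

lemma NoSmallMARS.rich_of_adj (hN : NoSmallMARS T) (hT : T.IsTree) {x y : V}
    (hxy : T.Adj x y) (hx : VertexRich T x) (hy : 0 < sideCard T y x 1)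
    (h1 : ∀ h, 2 ≤ sideCard T y x (h + 1) → sideCard T y x (h + 2) = 0 →
      sideCard T x y (h + 2) ≠ 1)
    (h2 : ∀ h, 2 ≤ sideCard T y x (h + 2) → sideCard T y x (h + 3) = 0 →
      sideCard T x y (h + 2) ≠ 1) : EdgeRich T x y ∧ VertexRich T y := by
  have he : EdgeRich T x y := by
    refine hN.edgeRich hT hxy fun h hsum => ?_
    have e1 := layerCard_eq hT hxy h
    have e2 := layerCard_eq hT hxy (h + 1)
    have r1 := hx h
    have r2 := hx (h + 1)
    rcases Nat.eq_zero_or_pos (sideCard T y x (h + 1)) with h0 | hpos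
    · cases h with
      | zero => simp only [Nat.reduceAdd] at *; omega
      | succ h => 
        simp only [Nat.add_assoc, Nat.reduceAdd] at *
        exact h1 h (by omega) h0 (by omega)
    · have := sideCard_eq_zero_of_le hT hxy (Nat.le_succ (h + 1)) (by omega)
      simp only [Nat.succ_eq_add_one] at this
      omega
  refine ⟨he, hN.vertexRich hT fun h hL => ?_⟩
  rw [layerCard_eq hT hxy.symm] at hL
  match h with
  | 0 =>
    rw [sideCard_zero hT hxy] at hL
    simp only [Nat.reduceAdd] at *
    omega
  | 1 =>
    have := hx.two_le_sideCard_one hT hxy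
    simp only [Nat.reduceAdd] at *
    omega
  | h + 2 =>
    have r1 := he (h + 1)
    have r2 := he (h + 2)
    rcases Nat.eq_zero_or_pos (sideCard T y x (h + 3)) with h0 | hpos
    · have := h2 h
      simp only [Nat.add_assoc, Nat.reduceAdd] at *
      omega
    · have := sideCard_eq_zero_of_le hT hxy (Nat.le_succ (h + 2))
        (by simp only [Nat.add_assoc, Nat.reduceAdd] at *; omega)
      simp only [Nat.succ_eq_add_one, Nat.add_assoc, Nat.reduceAdd] at *
      omega

lemma NoSmallMARS.rich_of_two_le_sideCard (hN : NoSmallMARS T) (hT : T.IsTree) {x y : V}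
    (hxy : T.Adj x y) (hx : VertexRich T x) (hy : 1 ≤ sideDepth hT x y)
    (hI : ∀ h, 2 ≤ h → h ≤ sideDepth hT x y + 1 → 2 ≤ sideCard T x y h) :
    EdgeRich T x y ∧ VertexRich T y := by
  refine hN.rich_of_adj hT hxy hx ((sideCard_pos_iff hT hxy 1).2 hy) (fun h h1 _ => ?_)
    (fun h h1 _ => ?_)
  · have := (sideCard_pos_iff hT hxy (h + 1)).1 (by omega)
    have := hI (h + 2) (by omega) (by omega)
    omega
  · have := (sideCard_pos_iff hT hxy (h + 2)).1 (by omega)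
    have := hI (h + 2) (by omega) (by omega)
    omega

lemma sideCard_two_eq_zero (hT : T.IsTree) {x y : V} (hxy : T.Adj x y)
    (h : sideDepth hT x y ≤ 1) : sideCard T y x 2 = 0 := by
  have := sideCard_pos_iff hT hxy 2
  omega

lemma NoSmallMARS.sideDepth_le_one (hN : NoSmallMARS T) (hT : T.IsTree) (n : ℕ) :
    ∀ {w z : V}, T.Adj w z → VertexRich T w → VertexRich T z →
      (∀ h, 2 ≤ h → h ≤ sideDepth hT w z + 1 → 2 ≤ sideCard T w z h) →
      sideDepth hT w z ≤ n → sideDepth hT w z ≤ 1 := by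
  classical
  induction n with
  | zero => intro w z _ _ _ _ h; omega
  | succ n ih =>
    intro w z hwz hw hz hI hn
    by_contra hd
    have hw1 := hw.two_le_sideCard_one hT hwz
    have hz1 := hz.two_le_sideCard_one hT hwz.symm
    have hchild : ∀ y, T.Adj z y → y ≠ w → 1 ≤ sideDepth hT z y →
        VertexRich T y ∧ EdgeRich T z y ∧ sideDepth hT z y ≤ 1 := by
      intro y hzy hyw hy1
      have hlt : sideDepth hT z y + 1 ≤ sideDepth hT w z := by
        rw [← sideCard_pos_iff hT hwz]
        exact lt_of_lt_of_le ((sideCard_pos_iff hT hzy _).2 le_rfl)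
          (sideCard_le_sideCard hT hwz.symm hzy hyw.symm _)
      have hI' : ∀ h, 2 ≤ h → h ≤ sideDepth hT z y + 1 → 2 ≤ sideCard T z y h := by
        intro h h2 hle
        obtain ⟨k, rfl⟩ := Nat.exists_eq_add_of_le' h2
        refine le_trans ?_ (sideCard_le_sideCard hT hzy hwz.symm hyw (k + 1))
        cases k with
        | zero => exact hw1
        | succ k => exact hI _ (by omega) (by omega)
      have hr := hN.rich_of_two_le_sideCard hT hzy hz hy1 hI'
      exact ⟨hr.2, hr.1, ih hzy hz hr.2 hI' (by omega)⟩
    obtain ⟨a, hza, haw, ha1⟩ : ∃ a, T.Adj z a ∧ a ≠ w ∧ 1 ≤ sideDepth hT z a := by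
      have h2 := (sideCard_pos_iff hT hwz 2).2 (by omega)
      rw [sideCard_succ hT hwz.symm] at h2
      obtain ⟨a, ha, hpos⟩ := Finset.sum_pos_iff.1 h2
      simp only [mem_erase, SimpleGraph.mem_neighborFinset] at ha
      exact ⟨a, ha.2, ha.1, (sideCard_pos_iff hT ha.2 1).1 hpos⟩
    obtain ⟨har, hae, had⟩ := hchild a hza haw ha1
    have ha2 := sideCard_two_eq_zero hT hza had
    obtain ⟨u, hau, -, hu⟩ := har.exists_leaf_of_sideCard_two_eq_zero hT hza.symm ha2
    have hzl := hN.not_hasLeafNeighbor hT hza.symm har hz hae.symm ⟨u, hau, hu⟩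
    obtain ⟨b, hzb, hbw, hba⟩ : ∃ b, T.Adj z b ∧ b ≠ w ∧ b ≠ a := by
      rw [sideCard_succ hT hwz.symm, ← Finset.add_sum_erase _ _ (a := a) (by simp [hza, haw]),
        sideCard_zero hT hza.symm] at hz1
      obtain ⟨b, hb, -⟩ := Finset.sum_pos_iff.1
        (Nat.lt_of_add_lt_add_left (n := 1) (lt_of_lt_of_le (Nat.lt_succ_self 1) hz1))
      simp only [mem_erase, SimpleGraph.mem_neighborFinset] at hb
      exact ⟨b, hb.2.2, hb.2.1, hb.1⟩
    have hb1 : 1 ≤ sideDepth hT z b := by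
      rw [← sideCard_pos_iff hT hzb]
      by_contra h0
      exact hzl ⟨b, hzb, by omega⟩
    obtain ⟨hbr, hbe, hbd⟩ := hchild b hzb hbw hb1
    exact hzl (hN.hasLeafNeighbor_of_stars hT hza.symm hzb hba.symm har hz ha2
      (hbr.two_le_sideCard_one hT hzb.symm) (sideCard_two_eq_zero hT hzb hbd))

lemma NoSmallMARS.star_of_sideDepth_le (hN : NoSmallMARS T) (hT : T.IsTree) {c : V}
    (hc : VertexRich T c) {s : Finset V} (hs : ∀ y ∈ s, T.Adj c y ∧ 1 ≤ sideDepth hT c y)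
    (hs3 : 3 ≤ s.card) :
    ∃ y ∈ s, VertexRich T y ∧ EdgeRich T c y ∧ sideCard T y c 2 = 0 := by
  classical
  obtain ⟨y, hy, hmin⟩ := s.exists_min_image (sideDepth hT c)
    (Finset.card_pos.1 (by omega))
  obtain ⟨z, hz, w, hw, hzw⟩ := Finset.one_lt_card.1
    (by rw [Finset.card_erase_of_mem hy]; omega : 1 < (s.erase y).card)
  simp only [mem_erase] at hz hw
  have hcy := (hs y hy).1
  have hcz := (hs z hz.2).1
  have hcw := (hs w hw.2).1
  have hI : ∀ h, 2 ≤ h → h ≤ sideDepth hT c y + 1 → 2 ≤ sideCard T c y h := by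
    intro h h2 hle
    obtain ⟨k, rfl⟩ := Nat.exists_eq_add_of_le' h2
    have h1 := sideCard_add_le_sideCard hT hcy hcz hcw hz.1.symm hw.1.symm hzw (k + 1)
    have h2 := (sideCard_pos_iff hT hcz (k + 1)).2 (le_trans (by omega) (hmin z hz.2))
    have h3 := (sideCard_pos_iff hT hcw (k + 1)).2 (le_trans (by omega) (hmin w hw.2))
    simp only [Nat.add_assoc, Nat.reduceAdd] at *
    omega
  have hr := hN.rich_of_two_le_sideCard hT hcy hc (hs y hy).2 hI
  exact ⟨y, hy, hr.2, hr.1, sideCard_two_eq_zero hT hcy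
    (hN.sideDepth_le_one hT _ hcy hc hr.2 hI le_rfl)⟩

lemma NoSmallMARS.card_nonleaf_le_two (hN : NoSmallMARS T) (hT : T.IsTree) {c : V}
    (hc : VertexRich T c) {s : Finset V} (hs : ∀ y ∈ s, T.Adj c y ∧ 1 ≤ sideDepth hT c y) :
    s.card ≤ 2 := by
  classical
  by_contra hs3
  obtain ⟨y, hy, hyr, hye, hy2⟩ := hN.star_of_sideDepth_le hT hc hs (by omega)
  have hcy := (hs y hy).1
  obtain ⟨u, hyu, -, hu⟩ := hyr.exists_leaf_of_sideCard_two_eq_zero hT hcy.symm hy2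
  have hcl := hN.not_hasLeafNeighbor hT hcy.symm hyr hc hye.symm ⟨u, hyu, hu⟩
  have h3 := hyr.three_le_sideCard_one hc hT hcy.symm hy2
  rw [sideCard_succ hT hcy, Finset.sum_congr rfl (g := fun _ => 1)] at h3
  swap
  · intro z hz
    simp only [mem_erase, SimpleGraph.mem_neighborFinset] at hz
    exact sideCard_zero hT hz.2.symm
  obtain ⟨w, hw, hwr, hwe, hw2⟩ := hN.star_of_sideDepth_le hT hc
    (s := (T.neighborFinset c).erase y) (fun z hz => by
      simp only [mem_erase, SimpleGraph.mem_neighborFinset] at hz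
      refine ⟨hz.2, ?_⟩
      rw [← sideCard_pos_iff hT hz.2]
      by_contra h0
      exact hcl ⟨z, hz.2, by omega⟩) (by simpa using h3)
  simp only [mem_erase, SimpleGraph.mem_neighborFinset] at hw
  exact hcl (hN.hasLeafNeighbor_of_stars hT hcy.symm hw.2 hw.1.symm hyr hc hy2
    (hwr.two_le_sideCard_one hT hw.2.symm) hw2)

lemma NoSmallMARS.hasLeafNeighbor (hN : NoSmallMARS T) (hT : T.IsTree) {c x : V}
    (hc : VertexRich T c) (hcx : T.Adj c x) : HasLeafNeighbor T c := by
  classical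
  by_contra hl
  have h2 := hN.card_nonleaf_le_two hT hc (s := T.neighborFinset c) fun z hz => by
    simp only [SimpleGraph.mem_neighborFinset] at hz
    refine ⟨hz, ?_⟩
    rw [← sideCard_pos_iff hT hz]
    by_contra h0
    exact hl ⟨z, hz, by omega⟩
  have h1 := layerCard_succ hT c 0
  rw [Finset.sum_congr rfl (g := fun _ => 1)] at h1
  swap
  · intro z hz
    exact sideCard_zero hT ((T.mem_neighborFinset c z).1 hz).symm
  have := layerCard_eq hT hcx 0
  have := sideCard_zero hT hcx.symm
  have := hc 0
  simp only [sum_const, smul_eq_mul, mul_one] at h1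
  omega

lemma NoSmallMARS.sideCard_sideDepth (hN : NoSmallMARS T) (hT : T.IsTree) {c x : V}
    (hc : VertexRich T c) (hcx : T.Adj c x) (hx : 1 ≤ sideDepth hT c x) :
    2 ≤ sideCard T x c (sideDepth hT c x) ∧
      (sideCard T c x (sideDepth hT c x + 1) = 1 ∨
        2 ≤ sideDepth hT c x ∧ sideCard T c x (sideDepth hT c x) = 1) := by
  by_contra hcon
  have hpos := sideCard_pos_iff hT hcx
  have hr := hN.rich_of_adj hT hcx hc ((hpos 1).2 hx) (fun h h1 h2 h3 => hcon ?_)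
    (fun h h1 h2 h3 => hcon ?_)
  · exact hN.not_hasLeafNeighbor hT hcx hc hr.2 hr.1 (hN.hasLeafNeighbor hT hc hcx)
      (hN.hasLeafNeighbor hT hr.2 hcx.symm)
  · have e : sideDepth hT c x = h + 1 := by
      have := hpos (h + 1)
      have := hpos (h + 2)
      omega
    rw [e]
    exact ⟨h1, .inl h3⟩
  · have e : sideDepth hT c x = h + 2 := by
      have := hpos (h + 2)
      have := hpos (h + 3)
      omega
    rw [e]
    exact ⟨h1, .inr ⟨by omega, h3⟩⟩

lemma NoSmallMARS.sideDepth_eq_zero (hN : NoSmallMARS T) (hT : T.IsTree) {c x : V}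
    (hc : VertexRich T c) (hcx : T.Adj c x) : sideDepth hT c x = 0 := by
  classical
  by_contra hx0
  have hx := hN.sideCard_sideDepth hT hc hcx (by omega)
  obtain ⟨k, hk⟩ : ∃ k, sideCard T c x (k + 2) = 1 := by
    rcases hx.2 with h | ⟨h2, h⟩
    · exact ⟨sideDepth hT c x - 1, by rwa [show sideDepth hT c x - 1 + 2 =
        sideDepth hT c x + 1 by omega]⟩
    · exact ⟨sideDepth hT c x - 2, by rwa [Nat.sub_add_cancel h2]⟩
  obtain ⟨y, hcy, hyx, hyk⟩ : ∃ y, T.Adj c y ∧ y ≠ x ∧ 0 < sideCard T y c (k + 1) := by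
    rw [sideCard_succ hT hcx] at hk
    obtain ⟨y, hy, hpos⟩ := Finset.sum_pos_iff.1 (hk.symm ▸ Nat.one_pos)
    simp only [mem_erase, SimpleGraph.mem_neighborFinset] at hy
    exact ⟨y, hy.2, hy.1, hpos⟩
  have hy0 : 1 ≤ sideDepth hT c y := by
    have := (sideCard_pos_iff hT hcy _).1 hyk
    omega
  have hy := hN.sideCard_sideDepth hT hc hcy hy0
  have hleaf : ∀ z, T.Adj c z → z ≠ x → z ≠ y → ∀ h, sideCard T z c (h + 1) = 0 := by
    intro z hcz hzx hzy h
    refine sideCard_eq_zero_of_le hT hcz.symm (Nat.le_add_left 1 h) ?_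
    by_contra hz0
    have := hN.card_nonleaf_le_two hT hc (s := {x, y, z}) (by
      simp only [mem_insert, mem_singleton, forall_eq_or_imp, forall_eq]
      exact ⟨⟨hcx, by omega⟩, ⟨hcy, hy0⟩, hcz,
        (sideCard_pos_iff hT hcz 1).1 (Nat.pos_of_ne_zero hz0)⟩)
    rw [Finset.card_eq_three.2 ⟨x, y, z, hyx.symm, hzx.symm, hzy.symm, rfl⟩] at this
    omega
  have hcx' : ∀ h, sideCard T c x (h + 2) = sideCard T y c (h + 1) := by
    intro h
    rw [sideCard_succ hT hcx]
    refine Finset.sum_eq_single_of_mem y (by simp [hcy, hyx]) fun z hz hzy => ?_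
    simp only [mem_erase, SimpleGraph.mem_neighborFinset] at hz
    exact hleaf z hz.2 hz.1 hzy h
  have hcy' : ∀ h, sideCard T c y (h + 2) = sideCard T x c (h + 1) := by
    intro h
    rw [sideCard_succ hT hcy]
    refine Finset.sum_eq_single_of_mem x (by simp [hcx, hyx.symm]) fun z hz hzx => ?_
    simp only [mem_erase, SimpleGraph.mem_neighborFinset] at hz
    exact hleaf z hz.2 hzx hz.1 h
  have hpx := sideCard_pos_iff hT hcx
  have hpy := sideCard_pos_iff hT hcy
  obtain ⟨a, ha⟩ : ∃ a, sideDepth hT c x = a + 1 := ⟨_, (Nat.sub_add_cancel (by omega)).symm⟩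
  obtain ⟨b, hb⟩ : ∃ b, sideDepth hT c y = b + 1 := ⟨_, (Nat.sub_add_cancel (by omega)).symm⟩
  rw [ha] at hx hpx
  rw [hb] at hy hpy
  simp only [Nat.add_assoc, Nat.reduceAdd, hcx', hcy'] at hx hy
  have key : ∀ (k : ℕ), sideCard T x c (k + 1) = 1 → sideCard T y c (k + 1) = 1 → False := by
    intro k h1 h2
    have := hc (k + 1)
    rw [layerCard_eq hT hcx] at this
    have := hcx' k
    simp only [Nat.add_assoc, Nat.reduceAdd] at *
    omega
  have hab : a = b → False := by
    rintro rfl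
    rcases hx with ⟨hx1, hx2 | ⟨hx2, hx3⟩⟩
    · omega
    · rcases hy with ⟨hy1, hy2 | ⟨hy2, hy3⟩⟩
      · omega
      · obtain ⟨k, rfl⟩ := Nat.exists_eq_add_of_le' (show 1 ≤ a by omega)
        simp only [hcx', hcy', Nat.add_assoc, Nat.reduceAdd] at hx3 hy3
        exact key k hy3 hx3
  have := hpx (b + 1)
  have := hpy (a + 1)
  have hxa : 1 ≤ a → sideCard T c x (a + 1) = sideCard T y c a := fun h => by
    obtain ⟨k, rfl⟩ := Nat.exists_eq_add_of_le' h
    exact hcx' k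
  have hyb : 1 ≤ b → sideCard T c y (b + 1) = sideCard T x c b := fun h => by
    obtain ⟨k, rfl⟩ := Nat.exists_eq_add_of_le' h
    exact hcy' k
  have := hpx b
  have := hpy a
  have hne : b ≠ a + 1 := by
    rintro rfl
    rcases hy with ⟨hy1, hy2 | ⟨hy2, hy3⟩⟩
    · omega
    · omega
  have hne' : a ≠ b + 1 := by
    rintro rfl
    rcases hx with ⟨hx1, hx2 | ⟨hx2, hx3⟩⟩
    · omega
    · omega
  apply hab
  omega

end RichVertices

section Center

variable {V : Type*} [Fintype V] {T : SimpleGraph V}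

lemma NoSmallMARS.vertexRich_of_two_le_sideCard (hN : NoSmallMARS T) (hT : T.IsTree) {x y : V}
    (hxy : T.Adj x y) {r : ℕ} (hx : ∀ h, 0 < sideCard T x y h ↔ h ≤ r)
    (hy : ∀ h, 0 < sideCard T y x h ↔ h ≤ r) (h2 : 2 ≤ sideCard T x y r) : VertexRich T y := by
  refine hN.vertexRich hT fun h hL => ?_
  rw [layerCard_eq hT hxy.symm] at hL
  have h1 := hx h
  have h3 := hy (h + 1)
  rcases eq_or_ne h r with rfl | hne <;> omega

lemma sideCard_pos_of_dist {x y v : V} (hv : T.dist y v = T.dist x v + 1) :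
    0 < sideCard T x y (T.dist x v) :=
  Finset.card_pos.2 ⟨v, by simp [hv]⟩

lemma NoSmallMARS.exists_vertexRich (hN : NoSmallMARS T) (hT : T.IsTree)
    (hdiam : 3 ≤ T.diam) :
    ∃ c x, T.Adj c x ∧ VertexRich T c ∧ 0 < sideCard T x c 1 := by
  classical
  have := hT.connected.nonempty
  let ecc : V → ℕ := fun x => univ.sup (T.dist x)
  have hecc : ∀ x v, T.dist x v ≤ ecc x := fun x v => Finset.le_sup (mem_univ v)
  have hattained : ∀ x, ∃ v, T.dist x v = ecc x := fun x => by
    obtain ⟨v, -, hv⟩ := Finset.exists_mem_eq_sup univ univ_nonempty (T.dist x)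
    exact ⟨v, hv.symm⟩
  obtain ⟨c, -, hmin⟩ := Finset.exists_min_image univ ecc univ_nonempty
  have he : 2 ≤ ecc c := by
    obtain ⟨u, v, huv⟩ := T.exists_dist_eq_diam
    have h1 := hT.connected.dist_triangle (u := u) (v := c) (w := v)
    have h2 := hecc c u
    have h3 := hecc c v
    rw [T.dist_comm] at h2
    omega
  obtain ⟨e, he'⟩ := Nat.exists_eq_add_of_le' he
  obtain ⟨v, hv⟩ := hattained c
  obtain ⟨y, hcy, hyv⟩ := hT.exists_adj_dist_lt (x := c) (v := v) (by
    rintro rfl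
    rw [T.dist_self] at hv
    omega)
  have hy := sideCard_pos_of_dist hyv
  rw [show T.dist y v = e + 1 by omega] at hy
  have hbound : ∀ x z, ∀ h, ecc x < h → sideCard T x z h = 0 := fun x z h hlt => by
    rw [sideCard, Finset.card_eq_zero, Finset.filter_eq_empty_iff]
    rintro w - ⟨hw, -⟩
    have := hecc x w
    omega
  have hbound' : ∀ x z, ∀ h, ecc x < h + 1 → sideCard T z x h = 0 := fun x z h hlt => by
    rw [sideCard, Finset.card_eq_zero, Finset.filter_eq_empty_iff]
    rintro w - ⟨-, hw⟩
    have := hecc x w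
    omega
  have hpy : ∀ h, 0 < sideCard T y c h ↔ h ≤ e + 1 := fun h => by
    have h1 := hbound' c y h
    have h2 := (sideCard_pos_iff hT hcy (e + 1)).1 hy
    have h3 := sideCard_pos_iff hT hcy h
    omega
  have hcpos := sideCard_pos_iff hT hcy.symm
  rcases Nat.eq_zero_or_pos (sideCard T c y (e + 2)) with h0 | hpos
  · have hc : 0 < sideCard T c y (e + 1) := by
      obtain ⟨w, hw⟩ := hattained y
      have h1 := hmin y (mem_univ y)
      have h2 := hecc c w
      rcases hT.dist_eq_or_dist_eq hcy w with h | h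
      · omega
      · have := sideCard_pos_of_dist h
        rw [hcpos] at this ⊢
        omega
    have hpc : ∀ h, 0 < sideCard T c y h ↔ h ≤ e + 1 := fun h => by
      have h1 := hcpos (e + 1)
      have h2 := hcpos (e + 2)
      have h3 := hcpos h
      omega
    have hE := hN.edgeRich hT hcy fun h => by
      have h1 := hpc (h + 1)
      have h2 := hpy (h + 1)
      omega
    have hE' := hE e
    rcases le_or_gt 2 (sideCard T c y (e + 1)) with h | h
    · exact ⟨y, c, hcy.symm, hN.vertexRich_of_two_le_sideCard hT hcy hpc hpy h,
        (hpc 1).2 (by omega)⟩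
    · exact ⟨c, y, hcy, hN.vertexRich_of_two_le_sideCard hT hcy.symm hpy hpc (by omega),
        (hpy 1).2 (by omega)⟩
  · refine ⟨c, y, hcy, hN.vertexRich hT fun h => ?_, (hpy 1).2 (by omega)⟩
    rw [layerCard_eq hT hcy]
    have h1 := hpy h
    have h2 := hcpos (e + 2)
    have h3 := hcpos (h + 1)
    have h4 := hbound c y (h + 1)
    omega

end Center

/-- every tree `T` of diameter at least three satisfies
`1 ≤ msad_2(T) ≤ 2`, i.e. it contains a `2`-multiset antiresolving set of cardinality
at most `2` (and at least `1`). -/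
theorem stmt12 {V : Type*} [Fintype V] (T : SimpleGraph V) (hT : T.IsTree)
    (hdiam : 3 ≤ T.diam) :
    ∃ S : Finset V, 1 ≤ S.card ∧ S.card ≤ 2 ∧ IsMARS T S 2 := by
  by_contra! hS
  have hN : NoSmallMARS T := fun S hS2 hM => hS S (Finset.card_pos.2 hM.1) hS2 hM
  obtain ⟨c, x, hcx, hc, hpos⟩ := hN.exists_vertexRich hT hdiam
  have h0 := hN.sideDepth_eq_zero hT hc hcx
  have h1 := (sideCard_pos_iff hT hcx 1).1 hpos
  omega
end

section
/- Let n ≥ 7 and let W_{1,n−1} be the wheel graph on n vertices with hub vertex 0. If S is a k-multiset antiresolving set of W_{1,n−1} for some k ≥ 4, then 0 ∈ S. -/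
open Finset

/-- The wheel graph `W_{1,m}` on `m + 1` vertices: the hub `none` is adjacent to every rim
vertex `some i`, and rim vertices `some i`, `some j` are adjacent iff `j ≡ i ± 1 (mod m)`. -/
def wheel (m : ℕ) : SimpleGraph (Option (Fin m)) :=
  SimpleGraph.fromRel (fun u v =>
    u = none ∨ ∃ i j : Fin m, u = some i ∧ v = some j ∧ (j : ℕ) = ((i : ℕ) + 1) % m)

/-- A vertex with the same multiset representation as `u` is adjacent to `s ∈ S` as soon as `u` is
adjacent to every vertex of `S`. -/
lemma adj_of_mrep_eq {V : Type*} {G : SimpleGraph V} {S : Finset V} {u v s : V}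
    (hu : ∀ t ∈ S, G.Adj u t) (h : mrep G S v = mrep G S u) (hs : s ∈ S) : G.Adj v s := by
  have hmem : G.dist v s ∈ mrep G S u := h ▸ Multiset.mem_map_of_mem _ hs
  obtain ⟨t, ht, hdist⟩ := Multiset.mem_map.1 hmem
  rw [SimpleGraph.dist_eq_one_iff_adj.2 (hu t ht)] at hdist
  exact SimpleGraph.dist_eq_one_iff_adj.1 hdist.symm

lemma wheel_adj_none_some {m : ℕ} (i : Fin m) : (wheel m).Adj none (some i) := by
  simp [wheel]

lemma wheel_adj_some_some {m : ℕ} {i j : Fin m} (h : (wheel m).Adj (some j) (some i)) :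
    (i : ℕ) = (j + 1) % m ∨ (j : ℕ) = (i + 1) % m := by
  simpa [wheel] using h.2

lemma rim_neighbor_eq {m : ℕ} {i j : Fin m}
    (h : (i : ℕ) = (j + 1) % m ∨ (j : ℕ) = (i + 1) % m) :
    (j : ℕ) = (i + 1) % m ∨ (j : ℕ) = (i + (m - 1)) % m := by
  refine h.symm.imp_right fun h => ?_
  rw [h, Nat.mod_add_mod, show (j : ℕ) + 1 + (m - 1) = j + m by omega, Nat.add_mod_right,
    Nat.mod_eq_of_lt j.2]

/-- If `S` avoids the hub, only the hub and the two rim neighbors of a vertex of `S` can have the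
same multiset representation as the hub. -/
lemma card_mclass_wheel_hub_le {m : ℕ} {S : Finset (Option (Fin m))} (hS : S.Nonempty)
    (h0 : none ∉ S) : (mclass (wheel m) S none).card ≤ 3 := by
  classical
  have hhub : ∀ t ∈ S, (wheel m).Adj none t := by
    rintro (_ | i) ht
    · exact absurd ht h0
    · exact wheel_adj_none_some i
  obtain ⟨_ | i, hi⟩ := hS
  · exact absurd hi h0
  have hm : 0 < m := i.pos
  refine (Finset.card_le_card (t := {none, some ⟨(i + 1) % m, Nat.mod_lt _ hm⟩,
    some ⟨(i + (m - 1)) % m, Nat.mod_lt _ hm⟩}) ?_).trans Finset.card_le_three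
  rintro (_ | j) hj
  · simp
  · simp only [mclass, Finset.mem_filter_univ] at hj
    have hadj := adj_of_mrep_eq hhub hj.2 hi
    simpa [Fin.ext_iff] using rim_neighbor_eq (wheel_adj_some_some hadj)

/-- for `n ≥ 7`, every `k`-multiset antiresolving set of the wheel
`W_{1,n-1}` with `k ≥ 4` contains the hub. -/
theorem stmt15 (n : ℕ) (hn : 7 ≤ n) (k : ℕ) (hk : 4 ≤ k)
    (S : Finset (Option (Fin (n - 1)))) (hS : IsMARS (wheel (n - 1)) S k) :
    none ∈ S := by
  by_contra h0
  have hle := hS.2.2.1 none h0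
  have hcard := card_mclass_wheel_hub_le hS.1 h0
  omega
end
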